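/- arXiv:math/0405459 — 2 statements merged into one kernel-verified Lean document; each statement's English description precedes it below -/
import Mathlib

section
/- Let α > 0 and assume that M_α(y;T) converges, uniformly in y ∈ [0,1], to ∫₀^y g_α(t) dt as T → ∞. If α = (a log p)/(2πq) with p prime and a, q coprime positive integers, then D*_α(T) = (1 + o(1)) · (log p)/(πq) · arcsin(p^{−a/2}) / log T as T → ∞. If α is not of this form, then D*_α(T) = o(1/log T). -/
open Filter MeasureTheory Real Complex Set

open Classical in
/-- Multiplicity of a point as a zero of the Riemann zeta function. -/
noncomputable def zetaZeroMult (ρ : ℂ) : ℕ :=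
  if h : AnalyticAt ℂ riemannZeta ρ then (analyticOrderAt riemannZeta ρ).toNat else 0

/-- Nontrivial zeros with imaginary part in `(0, T]`. -/
def zetaZerosUpTo (T : ℝ) : Set ℂ :=
  {ρ : ℂ | riemannZeta ρ = 0 ∧ 0 < ρ.re ∧ ρ.re < 1 ∧ 0 < ρ.im ∧ ρ.im ≤ T}

/-- `N(T)`: number of nontrivial zeros with `0 < γ ≤ T`, counted with multiplicity. -/
noncomputable def zetaN (T : ℝ) : ℕ := ∑ᶠ ρ ∈ zetaZerosUpTo T, zetaZeroMult ρ

/-- Explicit density `g` when `α = a log p / (2 π q)`. -/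
noncomputable def gPAQ (p a q : ℕ) (t : ℝ) : ℝ :=
  -(((p : ℝ) ^ ((a : ℝ) / 2) * Real.cos (2 * π * q * t) - 1) * Real.log p) /
    (π * ((p : ℝ) ^ (a : ℝ) - 2 * (p : ℝ) ^ ((a : ℝ) / 2) * Real.cos (2 * π * q * t) + 1))

/-- `α` has the special form `a log p / (2 π q)` with `p` prime, `a, q` coprime positive. -/
def IsSpecialForm (α : ℝ) (p a q : ℕ) : Prop :=
  p.Prime ∧ 0 < a ∧ 0 < q ∧ Nat.Coprime a q ∧ α = a * Real.log p / (2 * π * q)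

/-- `g` is the density `g_α` associated with `α`. -/
def IsDensityOf (α : ℝ) (g : ℝ → ℝ) : Prop :=
  (∀ p a q : ℕ, IsSpecialForm α p a q → g = gPAQ p a q) ∧
    ((¬ ∃ p a q : ℕ, IsSpecialForm α p a q) → g = 0)

/-- Sum of `h(αγ)` over zeros with `0 < γ ≤ T`, with multiplicity; `h` is `1`-periodic so this
equals the sum of `h({αγ})`. -/
noncomputable def zetaZeroSum (α : ℝ) (h : ℝ → ℂ) (T : ℝ) : ℂ :=
  ∑ᶠ ρ ∈ zetaZerosUpTo T, (zetaZeroMult ρ : ℂ) * h (α * ρ.im)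

/-- `h` is (a lift of) an absolutely continuous function on `𝕋 = ℝ/ℤ`, with derivative `h'`. -/
def IsAbsContTorus (h h' : ℝ → ℂ) : Prop :=
  Function.Periodic h 1 ∧ Function.Periodic h' 1 ∧
    (∀ a b : ℝ, IntervalIntegrable h' volume a b) ∧
    ∀ y : ℝ, h y = h 0 + ∫ t in (0:ℝ)..y, h' t

/-- `L¹` modulus of continuity on the torus. -/
noncomputable def modCont (f : ℝ → ℂ) (δ : ℝ) : ℝ :=
  sSup ((fun u => ∫ t in (0:ℝ)..1, ‖f (t + u) - f t‖) '' Set.Icc (-δ) δ)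

/-- `M_α(y;T)`. -/
noncomputable def Mfun (α y T : ℝ) : ℝ :=
  (1 / T) * (∑ᶠ ρ ∈ {ρ : ℂ | riemannZeta ρ = 0 ∧ 0 < ρ.re ∧ ρ.re < 1 ∧ 0 < ρ.im ∧ ρ.im ≤ T ∧
      Int.fract (α * ρ.im) < y}, (zetaZeroMult ρ : ℝ)) - y * (zetaN T) / T

/-- Normalized discrepancy `D*_α(T)`. -/
noncomputable def Dstar (α T : ℝ) : ℝ :=
  sSup ((fun y => (T / (zetaN T)) * |Mfun α y T|) '' Set.Icc (0:ℝ) 1)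

lemma fz_norm_mul_le {a b y : ℝ} (hb : 0 < b) (hab : b ≤ a) :
    ‖(a : ℂ) + y * I‖ * b ≤ ‖(b : ℂ) + y * I‖ * a := by
  rw [Complex.norm_add_mul_I, Complex.norm_add_mul_I]
  have ha : 0 < a := by linarith
  rw [← Real.sqrt_sq hb.le, ← Real.sqrt_sq ha.le, Real.sq_sqrt (by positivity),
    Real.sq_sqrt (by positivity), ← Real.sqrt_mul (by positivity), ← Real.sqrt_mul (by positivity)]
  apply Real.sqrt_le_sqrt
  have : b ^ 2 ≤ a ^ 2 := by gcongr
  nlinarith [sq_nonneg y]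

lemma fz_norm_GammaSeq {x y : ℝ} {n : ℕ} (hn : n ≠ 0) :
    ‖Complex.GammaSeq ((x : ℂ) + y * I) n‖ = (n : ℝ) ^ x * (n.factorial : ℝ) /
      ∏ j ∈ Finset.range (n + 1), ‖((x + j : ℝ) : ℂ) + y * I‖ := by
  unfold Complex.GammaSeq
  rw [norm_div, norm_mul, norm_prod]
  have h1 : ‖(n : ℂ) ^ ((x : ℂ) + y * I)‖ = (n : ℝ) ^ x := by
    rw [Complex.norm_natCast_cpow_of_pos (Nat.pos_of_ne_zero hn)]
    simp
  rw [h1, Complex.norm_natCast]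
  congr 1
  apply Finset.prod_congr rfl
  intro j _
  congr 1
  push_cast
  ring

lemma fz_norm_pos {x y : ℝ} (hx : 0 < x) : 0 < ‖(x : ℂ) + y * I‖ := by
  rw [norm_pos_iff]
  intro h
  have := congrArg Complex.re h
  simp at this
  linarith

lemma fz_GammaSeq_mono {x₀ x y : ℝ} (h0 : 0 < x₀) (hx : x₀ ≤ x) {n : ℕ} (hn : n ≠ 0) :
    ‖Complex.GammaSeq ((x₀ : ℂ) + y * I) n‖ * ‖Complex.GammaSeq ((x : ℂ) + (0 : ℝ) * I) n‖ ≤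
    ‖Complex.GammaSeq ((x : ℂ) + y * I) n‖ * ‖Complex.GammaSeq ((x₀ : ℂ) + (0 : ℝ) * I) n‖ := by
  rw [fz_norm_GammaSeq hn, fz_norm_GammaSeq hn, fz_norm_GammaSeq hn, fz_norm_GammaSeq hn]
  have hp : ∀ z w : ℝ, 0 < z → 0 < ∏ j ∈ Finset.range (n + 1), ‖((z + j : ℝ) : ℂ) + w * I‖ := by
    intro z w hz
    apply Finset.prod_pos
    intro j _
    apply fz_norm_pos
    positivity
  rw [div_mul_div_comm, div_mul_div_comm]
  have hx0 : 0 < x := by linarith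
  have key : (∏ j ∈ Finset.range (n + 1), ‖((x + j : ℝ) : ℂ) + y * I‖) *
      (∏ j ∈ Finset.range (n + 1), ‖((x₀ + j : ℝ) : ℂ) + (0 : ℝ) * I‖) ≤
      (∏ j ∈ Finset.range (n + 1), ‖((x₀ + j : ℝ) : ℂ) + y * I‖) *
      (∏ j ∈ Finset.range (n + 1), ‖((x + j : ℝ) : ℂ) + (0 : ℝ) * I‖) := by
    rw [← Finset.prod_mul_distrib, ← Finset.prod_mul_distrib]
    apply Finset.prod_le_prod
    · intro i _; positivity
    · intro i _
      have e : ∀ z : ℝ, 0 < z → ‖((z + i : ℝ) : ℂ) + (0 : ℝ) * I‖ = z + i := by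
        intro z hz
        simp only [ofReal_zero, zero_mul, add_zero]
        rw [Complex.norm_real, Real.norm_of_nonneg (by positivity)]
      rw [e _ h0, e _ hx0]
      apply fz_norm_mul_le (by positivity) (by linarith)
  calc _ = ((n : ℝ) ^ x * n.factorial) * ((n : ℝ) ^ x₀ * n.factorial) / _ := by
          rw [mul_comm ((n : ℝ) ^ x * n.factorial)]
    _ ≤ _ := by
        apply div_le_div_of_nonneg_left (by positivity) (mul_pos (hp _ _ hx0) (hp _ _ h0)) key

lemma fz_Gamma_mono {x₀ x y : ℝ} (h0 : 0 < x₀) (hx : x₀ ≤ x) :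
    ‖Complex.Gamma ((x₀ : ℂ) + y * I)‖ * Real.Gamma x ≤
    ‖Complex.Gamma ((x : ℂ) + y * I)‖ * Real.Gamma x₀ := by
  have e : ∀ z : ℝ, 0 < z → ‖Complex.Gamma ((z : ℂ) + (0 : ℝ) * I)‖ = Real.Gamma z := by
    intro z hz
    simp only [ofReal_zero, zero_mul, add_zero]
    rw [Complex.Gamma_ofReal, Complex.norm_real, Real.norm_of_nonneg (Real.Gamma_pos_of_pos hz).le]
  rw [← e x (by linarith), ← e x₀ h0]
  refine le_of_tendsto_of_tendsto
    ((Complex.GammaSeq_tendsto_Gamma _).norm.mul (Complex.GammaSeq_tendsto_Gamma _).norm)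
    ((Complex.GammaSeq_tendsto_Gamma _).norm.mul (Complex.GammaSeq_tendsto_Gamma _).norm) ?_
  filter_upwards [eventually_ne_atTop 0] with n hn
  exact fz_GammaSeq_mono h0 hx hn

lemma fz_Gamma_upper {x y : ℝ} (hx : 0 < x) :
    ‖Complex.Gamma ((x : ℂ) + y * I)‖ ≤ Real.Gamma x := by
  have e : ∀ z : ℝ, 0 < z → ‖Complex.Gamma ((z : ℂ) + (0 : ℝ) * I)‖ = Real.Gamma z := by
    intro z hz
    simp only [ofReal_zero, zero_mul, add_zero]
    rw [Complex.Gamma_ofReal, Complex.norm_real, Real.norm_of_nonneg (Real.Gamma_pos_of_pos hz).le]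
  rw [← e x hx]
  refine le_of_tendsto_of_tendsto (Complex.GammaSeq_tendsto_Gamma _).norm
    (Complex.GammaSeq_tendsto_Gamma _).norm ?_
  filter_upwards [eventually_ne_atTop 0] with n hn
  rw [fz_norm_GammaSeq hn, fz_norm_GammaSeq hn]
  apply div_le_div_of_nonneg_left (by positivity)
  · apply Finset.prod_pos
    intro j _
    apply fz_norm_pos
    positivity
  · apply Finset.prod_le_prod
    · intro i _; positivity
    · intro i _
      rw [Complex.norm_add_mul_I, Complex.norm_add_mul_I]
      apply Real.sqrt_le_sqrt
      nlinarith [sq_nonneg y]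

lemma fz_Gamma_half (y : ℝ) :
    Real.sqrt π * Real.exp (-(π * |y| / 2)) ≤ ‖Complex.Gamma (((1 / 2 : ℝ) : ℂ) + y * I)‖ := by
  have h := Complex.Gamma_mul_Gamma_one_sub (((1 / 2 : ℝ) : ℂ) + y * I)
  have hc : 1 - (((1 / 2 : ℝ) : ℂ) + y * I) = (starRingEnd ℂ) (((1 / 2 : ℝ) : ℂ) + y * I) := by
    simp only [map_add, map_mul, conj_ofReal, conj_I]
    push_cast
    ring
  rw [hc, Complex.Gamma_conj, Complex.mul_conj] at h
  have hs : Complex.sin (π * (((1 / 2 : ℝ) : ℂ) + y * I)) = (Real.cosh (π * y) : ℂ) := by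
    have : (π : ℂ) * (((1 / 2 : ℝ) : ℂ) + y * I) = (π * y : ℂ) * I + π / 2 := by
      push_cast; ring
    rw [this, Complex.sin_add_pi_div_two, Complex.cos_mul_I]
    push_cast; rfl
  rw [hs, Complex.normSq_eq_norm_sq] at h
  have h2 : ‖Complex.Gamma (((1 / 2 : ℝ) : ℂ) + y * I)‖ ^ 2 = π / Real.cosh (π * y) := by
    exact_mod_cast h
  apply le_of_sq_le_sq _ (norm_nonneg _)
  rw [h2, mul_pow, Real.sq_sqrt pi_pos.le, ← Real.exp_nat_mul, div_eq_mul_inv]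
  apply mul_le_mul_of_nonneg_left _ pi_pos.le
  rw [← Real.cosh_abs, abs_mul, abs_of_pos pi_pos]
  have h3 : Real.cosh (π * |y|) ≤ Real.exp (π * |y|) := by
    rw [Real.cosh_eq]
    have : Real.exp (-(π * |y|)) ≤ Real.exp (π * |y|) := by
      apply Real.exp_le_exp.mpr
      have : 0 ≤ π * |y| := by positivity
      linarith
    linarith
  refine le_trans (b := (Real.exp (π * |y|))⁻¹) ?_ ?_
  · rw [← Real.exp_neg]
    apply le_of_eq
    congr 1
    push_cast
    ring
  exact inv_anti₀ (Real.cosh_pos _) h3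

lemma fz_Gamma_lower {x y : ℝ} (hx : 1 / 2 ≤ x) :
    Real.exp (-(π * |y| / 2)) * Real.Gamma x ≤ ‖Complex.Gamma ((x : ℂ) + y * I)‖ := by
  have h := fz_Gamma_mono (x₀ := 1 / 2) (y := y) (by norm_num) hx
  rw [Real.Gamma_one_half_eq] at h
  have h2 := fz_Gamma_half y
  have hG : 0 < Real.Gamma x := Real.Gamma_pos_of_pos (by linarith)
  have h3 : Real.sqrt π * Real.exp (-(π * |y| / 2)) * Real.Gamma x ≤
      ‖Complex.Gamma ((x : ℂ) + y * I)‖ * Real.sqrt π :=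
    le_trans (mul_le_mul_of_nonneg_right h2 hG.le) h
  have h4 : 0 < Real.sqrt π := Real.sqrt_pos.mpr pi_pos
  nlinarith

lemma fz_logGamma_upper {x : ℝ} (hx : 1 ≤ x) : Real.log (Real.Gamma x) ≤ x * Real.log x := by
  have hlx : 0 ≤ Real.log x := Real.log_nonneg hx
  have hG : 0 < Real.Gamma x := Real.Gamma_pos_of_pos (by linarith)
  rcases le_total x 2 with h2 | h2
  · have hc := Real.convexOn_Gamma.2 (show (1 : ℝ) ∈ Ioi 0 by simp)
      (show (2 : ℝ) ∈ Ioi 0 by simp) (show 0 ≤ 2 - x by linarith) (show 0 ≤ x - 1 by linarith)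
      (by ring)
    simp only [smul_eq_mul, Real.Gamma_one, Real.Gamma_two] at hc
    have e : (2 - x) * 1 + (x - 1) * 2 = x := by ring
    rw [e] at hc
    have : Real.log (Real.Gamma x) ≤ 0 := Real.log_nonpos hG.le (by linarith)
    have h3 : 0 ≤ x * Real.log x := by positivity
    linarith
  · set n := ⌊x⌋₊ with hn
    have hnx : (n : ℝ) ≤ x := Nat.floor_le (by linarith)
    have hxn : x < n + 1 := Nat.lt_floor_add_one x
    have hn2 : 2 ≤ n := Nat.le_floor (by exact_mod_cast h2)
    have h1 : Real.Gamma x ≤ Real.Gamma (n + 1) :=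
      Real.Gamma_strictMonoOn_Ici.monotoneOn (by simpa using h2) (by simp; linarith) hxn.le
    rw [Real.Gamma_nat_eq_factorial] at h1
    have h4 : ((n.factorial : ℕ) : ℝ) ≤ (n : ℝ) ^ n := by exact_mod_cast Nat.factorial_le_pow n
    have hn0 : (1 : ℝ) ≤ n := by exact_mod_cast (by omega : 1 ≤ n)
    calc Real.log (Real.Gamma x) ≤ Real.log ((n : ℝ) ^ n) := Real.log_le_log hG (h1.trans h4)
      _ = n * Real.log n := by rw [Real.log_pow]
      _ ≤ x * Real.log x := by
        apply mul_le_mul hnx (Real.log_le_log (by linarith) hnx) (Real.log_nonneg hn0) (by linarith)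

lemma fz_logGamma_lower {x : ℝ} (hx : 1 ≤ x) :
    x * Real.log x - 3 * x ≤ Real.log (Real.Gamma x) := by
  have hlx : 0 ≤ Real.log x := Real.log_nonneg hx
  have hl1 : Real.log x ≤ x - 1 := Real.log_le_sub_one_of_pos (by linarith)
  have hG : 0 < Real.Gamma x := Real.Gamma_pos_of_pos (by linarith)
  set n := ⌊x⌋₊ with hn
  have hnx : (n : ℝ) ≤ x := Nat.floor_le (by linarith)
  have hxn : x < n + 1 := Nat.lt_floor_add_one x
  have hn1 : 1 ≤ n := Nat.le_floor (by exact_mod_cast hx)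
  have hn0 : (1 : ℝ) ≤ n := by exact_mod_cast hn1
  have h1 : Real.Gamma (n + 1) ≤ Real.Gamma (x + 1) :=
      Real.Gamma_strictMonoOn_Ici.monotoneOn (by simp; linarith) (by simp; linarith) (by linarith)
  rw [Real.Gamma_nat_eq_factorial, Real.Gamma_add_one (by linarith)] at h1
  have hst := Stirling.le_log_factorial_stirling (n := n) (by omega)
  have h5 : Real.log (n.factorial : ℝ) ≤ Real.log x + Real.log (Real.Gamma x) := by
    rw [← Real.log_mul (by linarith) hG.ne']
    exact Real.log_le_log (by positivity) h1
  have h6 : Real.log x ≤ Real.log n + 1 / n := by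
    have : Real.log (x / n) ≤ x / n - 1 := Real.log_le_sub_one_of_pos (by positivity)
    rw [Real.log_div (by linarith) (by linarith)] at this
    have h7 : x / n - 1 ≤ 1 / n := by
      rw [div_sub_one (by linarith)]
      apply div_le_div_of_nonneg_right (by linarith) (by linarith)
    linarith
  have hlp : 0 ≤ Real.log (2 * π) := Real.log_nonneg (by nlinarith [pi_gt_three])
  have hln : 0 ≤ Real.log n := Real.log_nonneg hn0
  have h8 : (n : ℝ) * Real.log x ≤ n * Real.log n + 1 := by
    have := mul_le_mul_of_nonneg_left h6 (by linarith : (0 : ℝ) ≤ n)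
    have e : (n : ℝ) * (Real.log n + 1 / n) = n * Real.log n + 1 := by field_simp
    linarith
  have h9 : (x - 1) * Real.log x ≤ n * Real.log x :=
    mul_le_mul_of_nonneg_right (by linarith) hlx
  nlinarith

/-- The entire function `s (s - 1) Λ(s)`. -/
noncomputable def fzXi (s : ℂ) : ℂ := s * (s - 1) * completedRiemannZeta₀ s + 1

lemma fzXi_differentiable : Differentiable ℂ fzXi := by
  unfold fzXi
  have := differentiable_completedZeta₀
  fun_prop

lemma fzXi_one_sub (s : ℂ) : fzXi (1 - s) = fzXi s := by
  unfold fzXi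
  rw [completedRiemannZeta₀_one_sub]
  ring

lemma fzXi_zero : fzXi 0 = 1 := by simp [fzXi]

lemma fzXi_eq {s : ℂ} (h0 : s ≠ 0) (h1 : s ≠ 1) :
    fzXi s = s * (s - 1) * completedRiemannZeta s := by
  unfold fzXi
  rw [completedRiemannZeta_eq]
  have : 1 - s ≠ 0 := sub_ne_zero.mpr h1.symm
  field_simp
  ring

lemma fzXi_eq_zeta {s : ℂ} (h0 : 0 < s.re) (h1 : s ≠ 1) :
    fzXi s = s * (s - 1) * Gammaℝ s * riemannZeta s := by
  have hs : s ≠ 0 := by rintro rfl; simp at h0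
  rw [fzXi_eq hs h1, riemannZeta_def_of_ne_zero hs]
  have := Complex.Gammaℝ_ne_zero_of_re_pos h0
  field_simp

lemma fz_completedZeta₀_bound :
    ∃ K : ℝ, 0 ≤ K ∧ ∀ s : ℂ, -1 ≤ s.re → s.re ≤ 2 → ‖completedRiemannZeta₀ s‖ ≤ K := by
  set P := HurwitzZeta.hurwitzEvenFEPair 0 with hP
  have hm : ∀ s : ℂ, MellinConvergent P.f_modif s := fun s =>
    (P.isStrongFEPair_toStrongFEPair.hasMellin s).1
  have hn : ∀ a : ℝ, IntegrableOn (fun t : ℝ => t ^ (a - 1) * ‖P.f_modif t‖) (Ioi 0) := by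
    intro a
    have := (hm (a : ℂ)).norm
    refine this.congr ?_
    filter_upwards [ae_restrict_mem measurableSet_Ioi] with t ht
    rw [norm_smul, Complex.norm_cpow_eq_rpow_re_of_pos ht]
    simp
  refine ⟨((∫ t in Ioi (0 : ℝ), t ^ ((1 : ℝ) - 1) * ‖P.f_modif t‖) +
    (∫ t in Ioi (0 : ℝ), t ^ ((-1 / 2 : ℝ) - 1) * ‖P.f_modif t‖)) / 2, ?_, ?_⟩
  · have h1 : ∀ a : ℝ, 0 ≤ ∫ t in Ioi (0 : ℝ), t ^ (a - 1) * ‖P.f_modif t‖ := by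
      intro a
      apply setIntegral_nonneg measurableSet_Ioi
      intro t ht
      have : (0 : ℝ) < t := ht
      positivity
    have := h1 1
    have := h1 (-1 / 2)
    positivity
  · intro s h1 h2
    have e : completedRiemannZeta₀ s = mellin P.f_modif (s / 2) / 2 := rfl
    rw [e, norm_div, Complex.norm_ofNat]
    apply div_le_div_of_nonneg_right _ (by norm_num)
    rw [← integral_add (hn _) (hn _), mellin]
    apply norm_integral_le_of_norm_le ((hn _).add (hn _))
    filter_upwards [ae_restrict_mem measurableSet_Ioi] with t ht
    have ht0 : (0 : ℝ) < t := ht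
    rw [norm_smul, Complex.norm_cpow_eq_rpow_re_of_pos ht0, Pi.add_apply, ← add_mul]
    apply mul_le_mul_of_nonneg_right _ (norm_nonneg _)
    have er : (s / 2 - 1).re = s.re / 2 - 1 := by simp
    rw [er]
    rcases le_total 1 t with h | h
    · have : t ^ (s.re / 2 - 1) ≤ t ^ ((1 : ℝ) - 1) :=
        Real.rpow_le_rpow_of_exponent_le h (by linarith)
      have : 0 ≤ t ^ ((-1 / 2 : ℝ) - 1) := by positivity
      linarith
    · have h5 : t ^ (s.re / 2 - 1) ≤ t ^ ((-1 / 2 : ℝ) - 1) :=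
        Real.rpow_le_rpow_of_exponent_ge ht0 h (by linarith)
      have h6 : 0 ≤ t ^ ((1 : ℝ) - 1) := by positivity
      exact le_add_of_nonneg_of_le h6 h5

lemma fz_zeta_sub_one {s : ℂ} (hs : 2 ≤ s.re) : ‖riemannZeta s - 1‖ ≤ 7 / 10 := by
  have hs1 : 1 < s.re := by linarith
  have hsum : Summable (fun n : ℕ => 1 / ((n : ℂ) + 1) ^ s) := by
    have := (summable_nat_add_iff 1).mpr (Complex.summable_one_div_nat_cpow.mpr hs1)
    simpa using this
  rw [zeta_eq_tsum_one_div_nat_add_one_cpow hs1, hsum.tsum_eq_zero_add]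
  simp only [Nat.cast_zero, zero_add, Complex.one_cpow, div_one, add_sub_cancel_left]
  have h2 : HasSum (fun n : ℕ => 1 / ((n : ℝ) + 2) ^ 2) (π ^ 2 / 6 - 1) := by
    have := (hasSum_nat_add_iff' 2).mpr hasSum_zeta_two
    simp [Finset.sum_range_succ] at this
    simpa using this
  have h3 : ‖∑' n : ℕ, 1 / (((n + 1 : ℕ) : ℂ) + 1) ^ s‖ ≤ π ^ 2 / 6 - 1 := by
    apply tsum_of_norm_bounded h2
    intro n
    rw [norm_div, norm_one]
    have : (((n + 1 : ℕ) : ℂ) + 1) = ((n + 2 : ℕ) : ℂ) := by push_cast; ring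
    rw [this, Complex.norm_natCast_cpow_of_pos (by omega)]
    apply one_div_le_one_div_of_le (by positivity)
    rw [← Real.rpow_natCast]
    push_cast
    apply Real.rpow_le_rpow_of_exponent_le _ hs
    have : (0 : ℝ) ≤ n := Nat.cast_nonneg n
    linarith
  have := pi_lt_d2
  have := pi_pos
  have h4 : π ^ 2 / 6 - 1 ≤ 7 / 10 := by nlinarith
  linarith

lemma fz_norm_Gammaℝ {s : ℂ} : ‖Gammaℝ s‖ =
    π ^ (-(s.re / 2)) * ‖Complex.Gamma (((s.re / 2 : ℝ) : ℂ) + ((s.im / 2 : ℝ) : ℂ) * I)‖ := by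
  rw [Complex.Gammaℝ_def, norm_mul, Complex.norm_cpow_eq_rpow_re_of_pos pi_pos]
  congr 3
  · simp; ring
  · apply Complex.ext <;> simp

lemma fzXi_norm {s : ℂ} (hs : 2 ≤ s.re) : 0 < ‖s‖ ∧ 1 ≤ ‖s - 1‖ ∧ 0 < ‖Gammaℝ s‖ ∧
    0 < ‖riemannZeta s‖ ∧ Real.log ‖fzXi s‖ = Real.log ‖s‖ + Real.log ‖s - 1‖ - s.re / 2 * Real.log π
      + Real.log ‖Complex.Gamma (((s.re / 2 : ℝ) : ℂ) + ((s.im / 2 : ℝ) : ℂ) * I)‖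
      + Real.log ‖riemannZeta s‖ := by
  have h0 : s ≠ 0 := by
    intro h
    rw [h, Complex.zero_re] at hs
    linarith
  have h1 : s ≠ 1 := by
    intro h
    rw [h, Complex.one_re] at hs
    linarith
  have hG : Gammaℝ s ≠ 0 := Complex.Gammaℝ_ne_zero_of_re_pos (by linarith)
  have hz : riemannZeta s ≠ 0 := riemannZeta_ne_zero_of_one_le_re (by linarith)
  have hn1 : 1 ≤ ‖s - 1‖ := by
    have := Complex.re_le_norm (s - 1)
    simp at this
    linarith
  refine ⟨norm_pos_iff.mpr h0, hn1, norm_pos_iff.mpr hG, norm_pos_iff.mpr hz, ?_⟩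
  have hGp : 0 < ‖Gammaℝ s‖ := norm_pos_iff.mpr hG
  have hs1 : s - 1 ≠ 0 := sub_ne_zero.mpr h1
  rw [fzXi_eq_zeta (by linarith) h1, norm_mul, norm_mul, norm_mul, Real.log_mul, Real.log_mul,
    Real.log_mul, fz_norm_Gammaℝ, Real.log_mul, Real.log_rpow pi_pos]
  · ring
  · positivity
  · rw [fz_norm_Gammaℝ] at hGp
    intro h
    rw [h] at hGp
    simp at hGp
  all_goals simp [h0, hs1, hG, hz]

lemma fzXi_upper_right {s : ℂ} (hs : 2 ≤ s.re) :
    Real.log ‖fzXi s‖ ≤ s.re / 2 * Real.log ‖s‖ + 5 * ‖s‖ := by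
  obtain ⟨h1, h2, h3, h4, h5⟩ := fzXi_norm hs
  rw [h5]
  have hsn : s.re ≤ ‖s‖ := Complex.re_le_norm s
  have a1 : Real.log ‖s‖ ≤ ‖s‖ - 1 := Real.log_le_sub_one_of_pos h1
  have a2 : Real.log ‖s - 1‖ ≤ ‖s‖ := by
    have := Real.log_le_sub_one_of_pos (by linarith : 0 < ‖s - 1‖)
    have h6 : ‖s - 1‖ ≤ ‖s‖ + 1 := by simpa using norm_sub_le s 1
    linarith
  have hlp : 0 ≤ Real.log π := Real.log_nonneg (by linarith [pi_gt_three])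
  have a3 : 0 ≤ s.re / 2 * Real.log π := by positivity
  have hGp : 0 < ‖Complex.Gamma (((s.re / 2 : ℝ) : ℂ) + ((s.im / 2 : ℝ) : ℂ) * I)‖ := by
    rw [fz_norm_Gammaℝ] at h3
    exact (pos_iff_pos_of_mul_pos h3).mp (by positivity)
  have a4 : Real.log ‖Complex.Gamma (((s.re / 2 : ℝ) : ℂ) + ((s.im / 2 : ℝ) : ℂ) * I)‖ ≤
      s.re / 2 * Real.log ‖s‖ := by
    calc _ ≤ Real.log (Real.Gamma (s.re / 2)) :=
          Real.log_le_log hGp (fz_Gamma_upper (by linarith))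
      _ ≤ s.re / 2 * Real.log (s.re / 2) := fz_logGamma_upper (by linarith)
      _ ≤ _ := by
        apply mul_le_mul_of_nonneg_left _ (by linarith)
        exact Real.log_le_log (by linarith) (by linarith)
  have a5 : Real.log ‖riemannZeta s‖ ≤ 1 := by
    have := Real.log_le_sub_one_of_pos h4
    have h6 := fz_zeta_sub_one hs
    have h7 : ‖riemannZeta s‖ ≤ ‖riemannZeta s - 1‖ + 1 := by
      simpa using norm_add_le (riemannZeta s - 1) 1
    linarith
  linarith

lemma fzXi_lower_right {s : ℂ} (hs : 2 ≤ s.re) :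
    s.re / 2 * Real.log ‖s‖ - 12 * ‖s‖ ≤ Real.log ‖fzXi s‖ := by
  obtain ⟨h1, h2, h3, h4, h5⟩ := fzXi_norm hs
  rw [h5]
  have hsn : s.re ≤ ‖s‖ := Complex.re_le_norm s
  have hin : |s.im| ≤ ‖s‖ := Complex.abs_im_le_norm s
  have a1 : 0 ≤ Real.log ‖s‖ := Real.log_nonneg (by linarith)
  have a2 : 0 ≤ Real.log ‖s - 1‖ := Real.log_nonneg h2
  have hlp : Real.log π ≤ 3 := by
    have := Real.log_le_sub_one_of_pos pi_pos
    linarith [pi_lt_four]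
  have a3 : s.re / 2 * Real.log π ≤ 3 / 2 * ‖s‖ := by nlinarith
  have hG : 0 < Real.Gamma (s.re / 2) := Real.Gamma_pos_of_pos (by linarith)
  have a4 : s.re / 2 * Real.log ‖s‖ - ‖s‖ - 3 / 2 * ‖s‖ - ‖s‖ ≤
      Real.log ‖Complex.Gamma (((s.re / 2 : ℝ) : ℂ) + ((s.im / 2 : ℝ) : ℂ) * I)‖ := by
    have b1 := fz_Gamma_lower (x := s.re / 2) (y := s.im / 2) (by linarith)
    have b2 := Real.log_le_log (by positivity) b1
    rw [Real.log_mul (by positivity) hG.ne', Real.log_exp] at b2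
    have b3 := fz_logGamma_lower (x := s.re / 2) (by linarith)
    have b4 : π * |s.im / 2| / 2 ≤ ‖s‖ := by
      rw [abs_div, abs_of_pos (by norm_num : (0 : ℝ) < 2)]
      nlinarith [pi_lt_four, pi_pos, abs_nonneg s.im]
    have b5 : s.re / 2 * Real.log ‖s‖ ≤ s.re / 2 * Real.log (s.re / 2) + ‖s‖ := by
      have c1 := Real.log_le_sub_one_of_pos (x := ‖s‖ / (s.re / 2)) (by positivity)
      rw [Real.log_div h1.ne' (by linarith)] at c1
      have c2 := mul_le_mul_of_nonneg_left c1 (by linarith : 0 ≤ s.re / 2)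
      have c3 : s.re / 2 * (‖s‖ / (s.re / 2) - 1) = ‖s‖ - s.re / 2 := by
        have : s.re ≠ 0 := by linarith
        field_simp
      linarith
    linarith
  have a5 : -4 ≤ Real.log ‖riemannZeta s‖ := by
    have h6 := fz_zeta_sub_one hs
    have h7 : 1 ≤ ‖riemannZeta s‖ + ‖riemannZeta s - 1‖ := by
      have := norm_sub_le (riemannZeta s) (riemannZeta s - 1)
      simpa using this
    have h8 : 3 / 10 ≤ ‖riemannZeta s‖ := by linarith
    have h9 := Real.one_sub_inv_le_log_of_pos h4
    have h10 : ‖riemannZeta s‖⁻¹ ≤ (3 / 10)⁻¹ := inv_anti₀ (by norm_num) h8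
    norm_num at h10
    linarith
  linarith

lemma fzXi_upper : ∃ C : ℝ, 0 < C ∧ ∀ s : ℂ, 2 ≤ ‖s‖ →
    Real.log ‖fzXi s‖ ≤ |s.re| / 2 * Real.log ‖s‖ + C * ‖s‖ := by
  obtain ⟨K, hK, hb⟩ := fz_completedZeta₀_bound
  refine ⟨15 + K, by linarith, fun s hs => ?_⟩
  have hl0 : 0 ≤ Real.log ‖s‖ := Real.log_nonneg (by linarith)
  have hl1 : Real.log ‖s‖ ≤ ‖s‖ - 1 := Real.log_le_sub_one_of_pos (by linarith)
  have hKs : 0 ≤ K * ‖s‖ := by positivity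
  have hre : |s.re| ≤ ‖s‖ := Complex.abs_re_le_norm s
  by_cases h2 : 2 ≤ s.re
  · have := fzXi_upper_right h2
    rw [abs_of_nonneg (by linarith)]
    nlinarith
  by_cases h1 : s.re ≤ -1
  · have h3 := fzXi_upper_right (s := 1 - s) (by simp; linarith)
    rw [fzXi_one_sub] at h3
    have h4 : ‖1 - s‖ ≤ 1 + ‖s‖ := by simpa using norm_sub_le 1 s
    have h5 : (1 - s).re = |s.re| + 1 := by
      rw [abs_of_neg (by linarith)]; simp; ring
    rw [h5] at h3
    have h6 : 0 < ‖1 - s‖ := by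
      have := Complex.re_le_norm (1 - s)
      have := abs_nonneg s.re
      linarith
    have h7 : Real.log ‖1 - s‖ ≤ Real.log ‖s‖ + 1 := by
      have : Real.log ‖1 - s‖ ≤ Real.log (2 * ‖s‖) := Real.log_le_log h6 (by linarith)
      rw [Real.log_mul (by norm_num) (by linarith)] at this
      have h8 := Real.log_le_sub_one_of_pos (by norm_num : (0 : ℝ) < 2)
      linarith
    have h9 : (|s.re| + 1) / 2 * Real.log ‖1 - s‖ ≤ (|s.re| + 1) / 2 * (Real.log ‖s‖ + 1) :=
      mul_le_mul_of_nonneg_left h7 (by positivity)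
    nlinarith
  · push Not at h2 h1
    have h3 := hb s h1.le h2.le
    have h4 : ‖s - 1‖ ≤ ‖s‖ + 1 := by simpa using norm_sub_le s 1
    have h5 : ‖fzXi s‖ ≤ (K + 1) * (2 * ‖s‖) ^ 2 := by
      unfold fzXi
      calc _ ≤ ‖s * (s - 1) * completedRiemannZeta₀ s‖ + ‖(1 : ℂ)‖ := norm_add_le _ _
        _ = ‖s‖ * ‖s - 1‖ * ‖completedRiemannZeta₀ s‖ + 1 := by simp
        _ ≤ ‖s‖ * (‖s‖ + 1) * K + 1 := by gcongr
        _ ≤ _ := by nlinarith [mul_nonneg hK (sq_nonneg ‖s‖)]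
    have hab : 0 ≤ |s.re| / 2 * Real.log ‖s‖ := by positivity
    by_cases hz : fzXi s = 0
    · rw [hz]; simp; positivity
    · have h6 := Real.log_le_log (norm_pos_iff.mpr hz) h5
      rw [Real.log_mul (by positivity) (by positivity), Real.log_pow,
        Real.log_mul (by norm_num) (by positivity)] at h6
      have h7 := Real.log_le_sub_one_of_pos (by linarith : 0 < K + 1)
      have h8 := Real.log_le_sub_one_of_pos (by norm_num : (0 : ℝ) < 2)
      push_cast at h6
      nlinarith

lemma fzXi_lower : ∃ C : ℝ, 0 < C ∧ ∀ s : ℂ, 2 ≤ ‖s‖ → (2 ≤ s.re ∨ s.re ≤ -1) →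
    |s.re| / 2 * Real.log ‖s‖ - C * ‖s‖ ≤ Real.log ‖fzXi s‖ := by
  refine ⟨24, by norm_num, fun s hs h => ?_⟩
  have hl0 : 0 ≤ Real.log ‖s‖ := Real.log_nonneg (by linarith)
  rcases h with h | h
  · have := fzXi_lower_right h
    rw [abs_of_nonneg (by linarith)]
    linarith
  · have h3 := fzXi_lower_right (s := 1 - s) (by simp; linarith)
    rw [fzXi_one_sub] at h3
    have h4 : ‖1 - s‖ ≤ 1 + ‖s‖ := by simpa using norm_sub_le 1 s
    have h5 : (1 - s).re = |s.re| + 1 := by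
      rw [abs_of_neg (by linarith)]; simp; ring
    rw [h5] at h3
    have h6 : ‖s‖ ≤ ‖1 - s‖ := by
      rw [Complex.norm_eq_sqrt_sq_add_sq, Complex.norm_eq_sqrt_sq_add_sq]
      apply Real.sqrt_le_sqrt
      simp
      nlinarith
    have h7 : Real.log ‖s‖ ≤ Real.log ‖1 - s‖ := Real.log_le_log (by linarith) h6
    have h8 : |s.re| / 2 * Real.log ‖s‖ ≤ (|s.re| + 1) / 2 * Real.log ‖1 - s‖ :=
      mul_le_mul (by linarith) h7 hl0 (by positivity)
    linarith

lemma fz_order_ne_top {f : ℂ → ℂ} (hf : Differentiable ℂ f) {c : ℂ} (hc : f c ≠ 0) (u : ℂ) :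
    analyticOrderAt f u ≠ ⊤ := by
  intro h
  rw [analyticOrderAt_eq_top] at h
  have h2 : AnalyticOnNhd ℂ f univ := fun z _ => hf.analyticAt z
  have := h2.eqOn_zero_of_preconnected_of_eventuallyEq_zero isPreconnected_univ (mem_univ u) h
  exact hc (this (mem_univ c))

lemma fz_order_eq_zero {f : ℂ → ℂ} (hf : Differentiable ℂ f) {c : ℂ} (hc : f c ≠ 0) (u : ℂ) :
    (analyticOrderAt f u).toNat = 0 ↔ f u ≠ 0 := by
  rw [ENat.toNat_eq_zero, (hf.analyticAt u).analyticOrderAt_eq_zero]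
  simp [fz_order_ne_top hf hc u]

lemma fz_divisor {f : ℂ → ℂ} (hf : Differentiable ℂ f) (c : ℂ) (R : ℝ) (u : ℂ) :
    MeromorphicOn.divisor f (Metric.closedBall c R) u =
      if ‖u - c‖ ≤ R then ((analyticOrderAt f u).toNat : ℤ) else 0 := by
  have h2 : AnalyticOnNhd ℂ f (Metric.closedBall c R) := fun z _ => hf.analyticAt z
  split_ifs with h
  · rw [MeromorphicOn.AnalyticOnNhd.divisor_apply h2 (by simpa [dist_eq_norm] using h)]
    cases h3 : analyticOrderAt f u <;> simp
  · apply Function.locallyFinsuppWithin.apply_eq_zero_of_notMem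
    simpa [dist_eq_norm] using h

lemma fz_zeros_finite {f : ℂ → ℂ} (hf : Differentiable ℂ f) {c : ℂ} (hc : f c ≠ 0) (R : ℝ) :
    {u | f u = 0 ∧ ‖u - c‖ ≤ R}.Finite := by
  refine ((MeromorphicOn.divisor f (Metric.closedBall c R)).finiteSupport
    (isCompact_closedBall ..)).subset ?_
  rintro u ⟨h1, h2⟩
  rw [Function.mem_support, fz_divisor hf, if_pos h2]
  intro h
  exact (fz_order_eq_zero hf hc u).1 (by exact_mod_cast h) h1

lemma fz_jensen {f : ℂ → ℂ} (hf : Differentiable ℂ f) {c : ℂ} (hc : f c ≠ 0) {R : ℝ} (hR : 0 < R)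
    (S : Finset ℂ) (hS : ∀ u ∈ S, f u = 0) (hS2 : ∀ u, f u = 0 → ‖u - c‖ ≤ R → u ∈ S) :
    circleAverage (fun z => Real.log ‖f z‖) c R =
      ∑ u ∈ S, ((analyticOrderAt f u).toNat : ℝ) * Real.posLog (R / ‖u - c‖) + Real.log ‖f c‖ := by
  have h2 : AnalyticOnNhd ℂ f (Metric.closedBall c |R|) := fun z _ => hf.analyticAt z
  rw [h2.circleAverage_log_norm hR.ne' hc]
  congr 1
  rw [abs_of_pos hR]
  rw [finsum_eq_sum_of_support_subset (s := S)]
  · refine Finset.sum_congr rfl fun u hu => ?_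
    have hne : u ≠ c := by
      rintro rfl
      exact hc (hS u hu)
    have hpos : 0 < ‖u - c‖ := norm_pos_iff.2 (sub_ne_zero.2 hne)
    rw [fz_divisor hf]
    split_ifs with h
    · rw [Real.posLog_eq_log, norm_sub_rev]
      · simp [div_eq_mul_inv]
      · rw [abs_of_pos (by positivity)]
        rwa [one_le_div hpos]
    · rw [(Real.posLog_eq_zero_iff _).2]
      · simp
      · rw [abs_of_pos (by positivity), div_le_one hpos]
        exact (not_le.1 h).le
  · intro u hu
    rw [Function.mem_support, fz_divisor hf] at hu
    split_ifs at hu with h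
    · apply hS2 u _ h
      by_contra h3
      apply hu
      rw [(fz_order_eq_zero hf hc u).2 h3]
      simp
    · simp at hu

lemma fz_circle_ge {f : ℂ → ℂ} (hf : Differentiable ℂ f) {c : ℂ} (hc : f c ≠ 0) {R : ℝ}
    (hR : 0 < R) : Real.log ‖f c‖ ≤ circleAverage (fun z => Real.log ‖f z‖) c R := by
  rw [fz_jensen hf hc hR (fz_zeros_finite hf hc R).toFinset (by simp +contextual) (by simp +contextual)]
  have : 0 ≤ ∑ u ∈ (fz_zeros_finite hf hc R).toFinset,
      ((analyticOrderAt f u).toNat : ℝ) * Real.posLog (R / ‖u - c‖) :=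
    Finset.sum_nonneg fun u _ => mul_nonneg (Nat.cast_nonneg _) Real.posLog_nonneg
  linarith

lemma fz_circle_mono {f : ℂ → ℂ} (hf : Differentiable ℂ f) {c : ℂ} (hc : f c ≠ 0) {R R' : ℝ}
    (hR : 0 < R) (hRR : R ≤ R') : circleAverage (fun z => Real.log ‖f z‖) c R ≤
      circleAverage (fun z => Real.log ‖f z‖) c R' := by
  rw [fz_jensen hf hc hR (fz_zeros_finite hf hc R').toFinset (by simp +contextual)
    (by simp only [Finite.mem_toFinset, mem_ofPred_eq]; exact fun u h1 h2 => ⟨h1, h2.trans hRR⟩),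
    fz_jensen hf hc (hR.trans_le hRR) (fz_zeros_finite hf hc R').toFinset (by simp +contextual)
    (by simp +contextual)]
  gcongr

lemma fz_circleIntegrable {f : ℂ → ℂ} (hf : Differentiable ℂ f) (c : ℂ) (R : ℝ) :
    CircleIntegrable (fun z => Real.log ‖f z‖) c R :=
  MeromorphicOn.circleIntegrable_log_norm (fun z _ => (hf.analyticAt z).meromorphicAt)

lemma fz_circle_eq {f : ℂ → ℂ} (c : ℂ) (R : ℝ) :
    2 * π * circleAverage (fun z => Real.log ‖f z‖) c R =
      ∫ θ in (-π)..π, Real.log ‖f (circleMap c R θ)‖ := by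
  rw [circleAverage_def, smul_eq_mul, mul_inv_cancel_left₀ (by positivity)]
  have t₀ : (fun θ ↦ Real.log ‖f (circleMap c R θ)‖).Periodic (2 * π) :=
    fun x ↦ by simp [periodic_circleMap c R x]
  have := t₀.intervalIntegral_add_eq 0 (-π)
  rw [zero_add] at this
  rw [this]
  congr 1
  ring

lemma fz_circle_intervalIntegrable {f : ℂ → ℂ} (hf : Differentiable ℂ f) (c : ℂ) (R : ℝ) :
    IntervalIntegrable (fun θ => Real.log ‖f (circleMap c R θ)‖) volume (-π) π := by
  have t₀ : (fun θ ↦ Real.log ‖f (circleMap c R θ)‖).Periodic (2 * π) :=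
    fun x ↦ by simp [periodic_circleMap c R x]
  exact t₀.intervalIntegrable₀ (by positivity) (fz_circleIntegrable hf c R) _ _

lemma fz_polar {F : ℂ → ENNReal} (hF : Measurable F) : ∫⁻ z, F z =
    ∫⁻ r in Ioi (0:ℝ), ENNReal.ofReal r * ∫⁻ θ in Ioc (-π) π, F (circleMap 0 r θ) := by
  rw [← Complex.lintegral_comp_polarCoord_symm F]
  have h1 : polarCoord.target = Ioi (0:ℝ) ×ˢ Ioo (-π) π := rfl
  have h2 : ∀ p : ℝ × ℝ, Complex.polarCoord.symm p = circleMap 0 p.1 p.2 := by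
    intro p
    rw [Complex.polarCoord_symm_apply, circleMap, Complex.exp_mul_I]
    simp
  have hm : Measurable fun p : ℝ × ℝ => circleMap 0 p.1 p.2 := by
    unfold circleMap
    fun_prop
  rw [h1, Measure.volume_eq_prod, ← Measure.prod_restrict]
  simp_rw [h2, smul_eq_mul]
  rw [lintegral_prod _ (by
    apply Measurable.aemeasurable
    exact (ENNReal.measurable_ofReal.comp measurable_fst).mul (hF.comp hm))]
  refine lintegral_congr fun r => ?_
  dsimp only
  rw [lintegral_const_mul]
  · rw [restrict_Ioo_eq_restrict_Ioc]
  · exact hF.comp (hm.comp (measurable_const.prodMk measurable_id))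

lemma fz_area {f : ℂ → ℂ} (hf : Differentiable ℂ f) {c : ℂ} (hc : f c ≠ 0) {M : ℝ}
    (hM : ∀ z, ‖z - c‖ < 10 → Real.log ‖f z‖ ≤ M) :
    ∫⁻ z in Metric.ball c 10, ENNReal.ofReal (M - Real.log ‖f z‖) ≤
      ENNReal.ofReal (200 * π * (M - Real.log ‖f c‖)) := by
  have hmeas : Measurable fun z => ENNReal.ofReal (M - Real.log ‖f z‖) := by
    have := hf.continuous.measurable
    fun_prop
  have hMc : 0 ≤ M - Real.log ‖f c‖ := by
    have := hM c (by simp)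
    linarith
  rw [← lintegral_indicator Metric.isOpen_ball.measurableSet]
  rw [← lintegral_add_left_eq_self _ c]
  rw [fz_polar]
  swap
  · exact (hmeas.indicator Metric.isOpen_ball.measurableSet).comp (measurable_const_add c)
  calc _ ≤ ∫⁻ r in Ioi (0:ℝ), (Ioo (0:ℝ) 10).indicator
        (fun _ => ENNReal.ofReal (10 * (2 * π * (M - Real.log ‖f c‖)))) r := by
        refine setLIntegral_mono' measurableSet_Ioi fun r hr => ?_
        have hr : 0 < r := hr
        by_cases h10 : r < 10
        · rw [indicator_of_mem (show r ∈ Ioo (0:ℝ) 10 from ⟨hr, h10⟩), ENNReal.ofReal_mul (by norm_num)]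
          refine mul_le_mul' (ENNReal.ofReal_le_ofReal h10.le) ?_
          have hmem : ∀ θ, c + circleMap 0 r θ ∈ Metric.ball c 10 := by
            intro θ
            simp [abs_of_pos hr, h10]
          have he : ∀ θ, c + circleMap 0 r θ = circleMap c r θ := by
            intro θ
            simp [circleMap]
          simp_rw [indicator_of_mem (hmem _), he]
          rw [← ofReal_integral_eq_lintegral_ofReal]
          · apply ENNReal.ofReal_le_ofReal
            rw [← intervalIntegral.integral_of_le (by linarith [Real.pi_pos]),
              intervalIntegral.integral_sub (by simp) (fz_circle_intervalIntegrable hf c r),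
              ← fz_circle_eq]
            have := fz_circle_ge hf hc hr
            have := Real.pi_pos
            simp only [intervalIntegral.integral_const, smul_eq_mul]
            nlinarith
          · rw [← IntegrableOn, ← intervalIntegrable_iff_integrableOn_Ioc_of_le (by linarith [Real.pi_pos])]
            exact (by simp : IntervalIntegrable (fun _ => M) volume (-π) π).sub
              (fz_circle_intervalIntegrable hf c r)
          · refine Eventually.of_forall fun θ => ?_
            have := hM (circleMap c r θ) (by simp [circleMap, abs_of_pos hr, h10])
            simpa using this
        · have hmem : ∀ θ, c + circleMap 0 r θ ∉ Metric.ball c 10 := by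
            intro θ
            simpa [abs_of_pos hr] using h10
          simp_rw [indicator_of_notMem (hmem _)]
          simp
    _ ≤ ∫⁻ r, (Ioo (0:ℝ) 10).indicator
        (fun _ => ENNReal.ofReal (10 * (2 * π * (M - Real.log ‖f c‖)))) r := setLIntegral_le_lintegral _ _
    _ = _ := by
      rw [lintegral_indicator measurableSet_Ioo]
      simp only [lintegral_const, MeasurableSet.univ, Measure.restrict_apply, univ_inter, Real.volume_Ioo]
      rw [← ENNReal.ofReal_mul (by positivity)]
      congr 1
      ring

lemma fz_int_abs_cos : ∫ θ in (-π)..π, |Real.cos θ| = 4 := by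
  have hi : ∀ a b : ℝ, IntervalIntegrable (fun θ => |Real.cos θ|) volume a b := fun a b =>
    (by fun_prop : Continuous fun θ => |Real.cos θ|).intervalIntegrable a b
  have hp := Real.pi_pos
  rw [← intervalIntegral.integral_add_adjacent_intervals (hi (-π) (-(π/2))) (hi (-(π/2)) π),
    ← intervalIntegral.integral_add_adjacent_intervals (hi (-(π/2)) (π/2)) (hi (π/2) π)]
  have h1 : ∫ θ in (-π)..(-(π/2)), |Real.cos θ| = ∫ θ in (-π)..(-(π/2)), -Real.cos θ := by
    refine intervalIntegral.integral_congr fun θ hθ => ?_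
    rw [uIcc_of_le (by linarith)] at hθ
    apply abs_of_nonpos
    rw [← Real.cos_neg]
    exact Real.cos_nonpos_of_pi_div_two_le_of_le (by linarith [hθ.2]) (by linarith [hθ.1])
  have h2 : ∫ θ in (-(π/2))..(π/2), |Real.cos θ| = ∫ θ in (-(π/2))..(π/2), Real.cos θ := by
    refine intervalIntegral.integral_congr fun θ hθ => ?_
    rw [uIcc_of_le (by linarith)] at hθ
    exact abs_of_nonneg (Real.cos_nonneg_of_mem_Icc hθ)
  have h3 : ∫ θ in (π/2)..π, |Real.cos θ| = ∫ θ in (π/2)..π, -Real.cos θ := by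
    refine intervalIntegral.integral_congr fun θ hθ => ?_
    rw [uIcc_of_le (by linarith)] at hθ
    apply abs_of_nonpos
    exact Real.cos_nonpos_of_pi_div_two_le_of_le (by linarith [hθ.1]) (by linarith [hθ.2])
  rw [h1, h2, h3]
  simp
  norm_num

lemma fz_int_main (A B : ℝ) : ∫ θ in (-π)..π, (A * |Real.cos θ| + B) = 4 * A + 2 * π * B := by
  have hi : IntervalIntegrable (fun θ => A * |Real.cos θ|) volume (-π) π :=
    (by fun_prop : Continuous fun θ => A * |Real.cos θ|).intervalIntegrable _ _
  rw [intervalIntegral.integral_add hi (by simp), intervalIntegral.integral_const_mul,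
    fz_int_abs_cos, intervalIntegral.integral_const, smul_eq_mul]
  ring

lemma fz_circleMap_re (r θ : ℝ) : (circleMap 0 r θ).re = r * Real.cos θ := by
  simp [circleMap, Complex.exp_ofReal_mul_I_re]

lemma fz_J_upper : ∃ C, 0 < C ∧ ∀ R, 2 ≤ R →
    circleAverage (fun z => Real.log ‖fzXi z‖) 0 R ≤ R * Real.log R / π + C * R := by
  obtain ⟨C, hC, h⟩ := fzXi_upper
  refine ⟨C, hC, fun R hR => ?_⟩
  have hpi := Real.pi_pos
  have h1 : 2 * π * circleAverage (fun z => Real.log ‖fzXi z‖) 0 R ≤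
      4 * (R * Real.log R / 2) + 2 * π * (C * R) := by
    rw [fz_circle_eq, ← fz_int_main]
    refine intervalIntegral.integral_mono_on (by linarith)
      (fz_circle_intervalIntegrable fzXi_differentiable _ _)
      ((by fun_prop : Continuous fun θ => (R * Real.log R / 2) * |Real.cos θ| + C * R).intervalIntegrable
        _ _) fun θ _ => ?_
    have hn : ‖circleMap 0 R θ‖ = R := by simp; linarith
    have := h (circleMap 0 R θ) (by rw [hn]; exact hR)
    rw [hn, fz_circleMap_re, abs_mul, abs_of_pos (by linarith)] at this
    linarith
  have h2 : 2 * π * (R * Real.log R / π + C * R) = 4 * (R * Real.log R / 2) + 2 * π * (C * R) := by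
    field_simp
    ring
  rw [← h2] at h1
  exact le_of_mul_le_mul_left h1 (by positivity)

lemma fz_annulus {R : ℝ} (hR : 100 ≤ R) {z : ℂ} (h1 : R < ‖z‖) (h2 : ‖z‖ < R + 1)
    (h3 : -1 < z.re) (h4 : z.re < 2) :
    z ∈ Metric.ball (3 + R * I) 10 ∨ z ∈ Metric.ball (3 - R * I) 10 := by
  have key : ‖z‖ ^ 2 = z.re ^ 2 + z.im ^ 2 := by
    rw [← Complex.normSq_eq_norm_sq, Complex.normSq_apply]
    ring
  have h5 : |z.im| ≤ ‖z‖ := Complex.abs_im_le_norm z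
  have h6 : R - 1 ≤ |z.im| := by
    by_contra h
    push Not at h
    have := sq_abs z.im
    have := abs_nonneg z.im
    nlinarith
  rcases le_total 0 z.im with h | h
  · left
    rw [abs_of_nonneg h] at h5 h6
    rw [Metric.mem_ball, dist_eq_norm]
    refine (Complex.norm_le_abs_re_add_abs_im _).trans_lt ?_
    simp only [sub_re, add_re, mul_re, ofReal_re, ofReal_im, I_re, I_im, sub_im, add_im, mul_im]
    have a : |z.re - 3| < 5 := abs_lt.2 ⟨by linarith, by linarith⟩
    have b : |z.im - R| < 2 := abs_lt.2 ⟨by linarith, by linarith⟩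
    norm_num
    linarith
  · right
    rw [abs_of_nonpos h] at h5 h6
    rw [Metric.mem_ball, dist_eq_norm]
    refine (Complex.norm_le_abs_re_add_abs_im _).trans_lt ?_
    simp only [sub_re, mul_re, ofReal_re, ofReal_im, I_re, I_im, sub_im, mul_im]
    have a : |z.re - 3| < 5 := abs_lt.2 ⟨by linarith, by linarith⟩
    have b : |z.im + R| < 2 := abs_lt.2 ⟨by linarith, by linarith⟩
    norm_num
    linarith

lemma fzXi_ne_zero {s : ℂ} (hs : 1 < s.re) : fzXi s ≠ 0 := by
  have h1 : s ≠ 1 := by rintro rfl; simp at hs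
  have h0 : s ≠ 0 := by rintro rfl; simp at hs; linarith
  rw [fzXi_eq_zeta (by linarith) h1]
  exact mul_ne_zero (mul_ne_zero (mul_ne_zero h0 (sub_ne_zero.2 h1))
    (Gammaℝ_ne_zero_of_re_pos (by linarith))) (riemannZeta_ne_zero_of_one_lt_re hs)

lemma fz_G_meas {F : ℂ → ENNReal} (hF : Measurable F) :
    Measurable fun r : ℝ => ENNReal.ofReal r * ∫⁻ θ in Ioc (-π) π, F (circleMap 0 r θ) := by
  refine ENNReal.measurable_ofReal.mul ?_
  have hm : Measurable fun p : ℝ × ℝ => circleMap 0 p.1 p.2 := by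
    unfold circleMap
    fun_prop
  exact Measurable.lintegral_prod_right' (f := fun p : ℝ × ℝ => F (circleMap 0 p.1 p.2)) (hF.comp hm)

lemma fz_select {F : ℂ → ENNReal} (hF : Measurable F) {R K : ℝ} (hR : 0 < R)
    (h : ∫⁻ z, F z ≤ ENNReal.ofReal (K * R)) : ∃ r ∈ Ioo R (R + 1),
    ∫⁻ θ in Ioc (-π) π, F (circleMap 0 r θ) ≤ ENNReal.ofReal K := by
  obtain ⟨r, hr, h2⟩ := exists_le_setLAverage (μ := volume) (s := Ioo R (R + 1))
    (by simp) (by simp) (fz_G_meas hF).aemeasurable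
  refine ⟨r, hr, ?_⟩
  have h3 : (⨍⁻ r in Ioo R (R + 1), (ENNReal.ofReal r * ∫⁻ θ in Ioc (-π) π, F (circleMap 0 r θ)) ∂volume) ≤
      ENNReal.ofReal (K * R) := by
    rw [setLAverage_eq]
    simp only [Real.volume_Ioo, add_sub_cancel_left, ENNReal.ofReal_one, div_one]
    refine (lintegral_mono_set ?_).trans ((fz_polar hF).symm.le.trans h)
    intro x hx
    exact hR.trans hx.1
  have hr0 : 0 < r := hR.trans hr.1
  have h4 := h2.trans h3
  rw [ENNReal.ofReal_mul' hR.le, mul_comm] at h4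
  have h5 : ENNReal.ofReal K * ENNReal.ofReal R ≤ ENNReal.ofReal K * ENNReal.ofReal r :=
    mul_le_mul' le_rfl (ENNReal.ofReal_le_ofReal hr.1.le)
  exact (ENNReal.mul_le_mul_iff_left (by simpa using hr0) (by simp)).1 (h4.trans h5)

lemma fz_ball_facts {R : ℝ} (hR : 100 ≤ R) {c : ℂ} (hc : c = 3 + R * I ∨ c = 3 - R * I) :
    c.re = 3 ∧ R ≤ ‖c‖ ∧ ‖c‖ ≤ 2 * R ∧ (∀ z, ‖z - c‖ < 10 → |z.re| ≤ 13 ∧ 2 ≤ ‖z‖ ∧ ‖z‖ ≤ 2 * R) := by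
  have hre : c.re = 3 := by rcases hc with rfl | rfl <;> simp
  have him : |c.im| = R := by rcases hc with rfl | rfl <;> simp <;> linarith
  have h1 : R ≤ ‖c‖ := by rw [← him]; exact Complex.abs_im_le_norm c
  have h2 : ‖c‖ ≤ 3 + R := by
    have := Complex.norm_le_abs_re_add_abs_im c
    rw [hre, him] at this
    norm_num at this
    exact this
  refine ⟨hre, h1, by linarith, fun z hz => ⟨?_, ?_, ?_⟩⟩
  · have := (Complex.abs_re_le_norm (z - c)).trans hz.le
    rw [sub_re, hre] at this
    rw [abs_le] at this ⊢
    constructor <;> linarith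
  · have := norm_sub_norm_le c z
    rw [norm_sub_rev] at this
    linarith
  · have := norm_sub_norm_le z c
    linarith

lemma fz_J_lower_core : ∃ C, 0 < C ∧ ∀ R, 100 ≤ R → ∃ r ∈ Ioo R (R + 1),
    r * Real.log r / π - C * r ≤ circleAverage (fun z => Real.log ‖fzXi z‖) 0 r := by
  obtain ⟨C1, hC1, hup⟩ := fzXi_upper
  obtain ⟨C2, hC2, hlo⟩ := fzXi_lower
  have hpi := Real.pi_pos
  set K : ℝ := 2 * (200 * π * (13 + 2 * C1 + 2 * C2)) with hK
  have hK0 : 0 < K := by positivity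
  refine ⟨C2 + 13 + K, by positivity, fun R hR => ?_⟩
  set M : ℝ := (13 + 2 * C1) * R with hM
  have hM0 : 0 ≤ M := by positivity
  have hmeas : Measurable fun z => ENNReal.ofReal (M - Real.log ‖fzXi z‖) := by
    have := fzXi_differentiable.continuous.measurable
    fun_prop
  have harea : ∀ c : ℂ, (c = 3 + R * I ∨ c = 3 - R * I) →
      ∫⁻ z in Metric.ball c 10, ENNReal.ofReal (M - Real.log ‖fzXi z‖) ≤
        ENNReal.ofReal (K / 2 * R) := by
    intro c hc
    obtain ⟨hre, h1, h2, h3⟩ := fz_ball_facts hR hc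
    refine (fz_area fzXi_differentiable (fzXi_ne_zero (by rw [hre]; norm_num)) (M := M) ?_).trans ?_
    · intro z hz
      obtain ⟨a1, a2, a3⟩ := h3 z hz
      refine (hup z a2).trans ?_
      have l1 : Real.log ‖z‖ ≤ 2 * R := (Real.log_le_self (by positivity)).trans a3
      have l2 : |z.re| / 2 * Real.log ‖z‖ ≤ 13 / 2 * (2 * R) := by
        refine mul_le_mul (by linarith) l1 (Real.log_nonneg (by linarith)) (by norm_num)
      have l3 : C1 * ‖z‖ ≤ C1 * (2 * R) := by gcongr
      rw [hM]
      linarith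
    · apply ENNReal.ofReal_le_ofReal
      have h4 := hlo c (by linarith) (Or.inl (by rw [hre]; norm_num))
      have l0 : 0 ≤ |c.re| / 2 * Real.log ‖c‖ :=
        mul_nonneg (by positivity) (Real.log_nonneg (by linarith))
      have l3 : C2 * ‖c‖ ≤ C2 * (2 * R) := by gcongr
      have l4 : M - Real.log ‖fzXi c‖ ≤ (13 + 2 * C1 + 2 * C2) * R := by
        rw [hM]
        linarith
      calc _ ≤ 200 * π * ((13 + 2 * C1 + 2 * C2) * R) := by gcongr
        _ = _ := by rw [hK]; ring
  set E : Set ℂ := Metric.ball (3 + R * I) 10 ∪ Metric.ball (3 - R * I) 10 with hE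
  have hEm : MeasurableSet E := (Metric.isOpen_ball.union Metric.isOpen_ball).measurableSet
  set F : ℂ → ENNReal := E.indicator fun z => ENNReal.ofReal (M - Real.log ‖fzXi z‖) with hF
  have hFm : Measurable F := hmeas.indicator hEm
  have hFi : ∫⁻ z, F z ≤ ENNReal.ofReal (K * R) := by
    rw [hF, lintegral_indicator hEm, hE]
    refine (lintegral_union_le _ _ _).trans ?_
    refine (add_le_add (harea _ (Or.inl rfl)) (harea _ (Or.inr rfl))).trans ?_
    rw [← ENNReal.ofReal_add (by positivity) (by positivity)]
    apply le_of_eq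
    congr 1
    ring
  obtain ⟨r, hr, hrF⟩ := fz_select hFm (by linarith) hFi
  refine ⟨r, hr, ?_⟩
  have hr1 : 100 < r := lt_of_le_of_lt hR hr.1
  set v : ℝ → ℝ := fun θ => (r * Real.log r / 2 * |Real.cos θ| + (-(C2 + 13) * r)) -
    Real.log ‖fzXi (circleMap 0 r θ)‖ with hv
  have hvF : ∀ θ, ENNReal.ofReal (v θ) ≤ F (circleMap 0 r θ) := by
    intro θ
    have hn : ‖circleMap 0 r θ‖ = r := by simp; linarith
    have hre := fz_circleMap_re r θ
    have hre2 : |(circleMap 0 r θ).re| = r * |Real.cos θ| := by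
      rw [hre, abs_mul, abs_of_pos (by linarith)]
    have hvv : v θ = |(circleMap 0 r θ).re| / 2 * Real.log r - (C2 + 13) * r -
      Real.log ‖fzXi (circleMap 0 r θ)‖ := by
      rw [hv, hre2]
      ring
    rw [hvv]
    by_cases hzE : circleMap 0 r θ ∈ E
    · rw [hF, indicator_of_mem hzE]
      apply ENNReal.ofReal_le_ofReal
      have hre3 : |(circleMap 0 r θ).re| ≤ 13 := by
        rcases hzE with h | h
        · exact ((fz_ball_facts hR (Or.inl rfl)).2.2.2 _ (by simpa [dist_eq_norm] using h)).1
        · exact ((fz_ball_facts hR (Or.inr rfl)).2.2.2 _ (by simpa [dist_eq_norm] using h)).1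
      have l1 : Real.log r ≤ r := Real.log_le_self (by linarith)
      have l2 : |(circleMap 0 r θ).re| / 2 * Real.log r ≤ 13 / 2 * r :=
        mul_le_mul (by linarith) l1 (Real.log_nonneg (by linarith)) (by norm_num)
      have l3 : 0 ≤ C2 * r := by positivity
      linarith
    · have hgood : 2 ≤ (circleMap 0 r θ).re ∨ (circleMap 0 r θ).re ≤ -1 := by
        by_contra h
        push Not at h
        exact hzE (fz_annulus hR (by rw [hn]; exact hr.1) (by rw [hn]; exact hr.2) h.2 h.1)
      have := hlo (circleMap 0 r θ) (by rw [hn]; linarith) hgood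
      rw [hn] at this
      rw [ENNReal.ofReal_of_nonpos]
      · exact zero_le
      · linarith
  have hvi : IntervalIntegrable v volume (-π) π :=
    ((by fun_prop : Continuous fun θ => r * Real.log r / 2 * |Real.cos θ| +
      (-(C2 + 13) * r)).intervalIntegrable _ _).sub
        (fz_circle_intervalIntegrable fzXi_differentiable 0 r)
  have hIv : ∫ θ in (-π)..π, v θ = 4 * (r * Real.log r / 2) + 2 * π * (-(C2 + 13) * r) -
      2 * π * circleAverage (fun z => Real.log ‖fzXi z‖) 0 r := by
    rw [fz_circle_eq, ← fz_int_main]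
    exact intervalIntegral.integral_sub ((by fun_prop : Continuous fun θ => r * Real.log r / 2 * |Real.cos θ| +
      (-(C2 + 13) * r)).intervalIntegrable _ _) (fz_circle_intervalIntegrable fzXi_differentiable 0 r)
  have hle : ∫ θ in (-π)..π, v θ ≤ K := by
    rw [intervalIntegral.integral_of_le (by linarith)]
    rw [intervalIntegrable_iff_integrableOn_Ioc_of_le (by linarith)] at hvi
    rw [integral_eq_lintegral_pos_part_sub_lintegral_neg_part hvi]
    have h1 : (∫⁻ θ in Ioc (-π) π, ENNReal.ofReal (v θ)).toReal ≤ K := by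
      refine ENNReal.toReal_le_of_le_ofReal hK0.le ?_
      exact (lintegral_mono hvF).trans hrF
    have h2 : 0 ≤ (∫⁻ θ in Ioc (-π) π, ENNReal.ofReal (-v θ)).toReal := ENNReal.toReal_nonneg
    linarith
  rw [hIv] at hle
  have h3 : 2 * π * (r * Real.log r / π - (C2 + 13 + K) * r) =
      4 * (r * Real.log r / 2) + 2 * π * (-(C2 + 13) * r) - 2 * π * K * r := by
    field_simp
    ring
  have h4 : K ≤ 2 * π * K * r := by
    have : 1 ≤ 2 * π * r := by nlinarith [Real.pi_gt_three]
    nlinarith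
  refine le_of_mul_le_mul_left ?_ (by positivity : 0 < 2 * π)
  rw [h3]
  linarith

lemma fz_J_lower : ∃ C, 0 < C ∧ ∀ R, 200 ≤ R →
    R * Real.log R / π - C * R ≤ circleAverage (fun z => Real.log ‖fzXi z‖) 0 R := by
  obtain ⟨C, hC, h⟩ := fz_J_lower_core
  refine ⟨C + 2, by positivity, fun R hR => ?_⟩
  obtain ⟨r, hr, h1⟩ := h (R - 1) (by linarith)
  have hr2 : r ≤ R := by linarith [hr.2]
  have h2 := fz_circle_mono fzXi_differentiable (c := 0) (by simp [fzXi_zero]) (by linarith [hr.1] : 0 < r) hr2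
  refine le_trans ?_ (h1.trans h2)
  have hpi := Real.pi_gt_three
  have hl : Real.log (R / r) ≤ R / r - 1 := Real.log_le_sub_one_of_pos (by
    have : 0 < r := by linarith [hr.1]
    positivity)
  have hr0 : 0 < r := by linarith [hr.1]
  rw [Real.log_div (by linarith) hr0.ne'] at hl
  have h3 : r * Real.log R ≤ r * Real.log r + R - r := by
    have : r * (Real.log R - Real.log r) ≤ r * (R / r - 1) := by gcongr
    have e : r * (R / r - 1) = R - r := by field_simp
    linarith
  have h4 : Real.log R ≤ R := Real.log_le_self (by linarith)
  have hl0 : 0 ≤ Real.log R := Real.log_nonneg (by linarith)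
  have h5 : R * Real.log R ≤ r * Real.log r + 1 + R := by
    have : (R - r) * Real.log R ≤ 1 * Real.log R := by
      gcongr
      linarith [hr.1]
    nlinarith [hr.1]
  have h6 : R * Real.log R / π ≤ r * Real.log r / π + 2 * R := by
    rw [div_le_iff₀ (by positivity), add_mul, div_mul_cancel₀ _ (by positivity)]
    nlinarith
  nlinarith

noncomputable def fzOrd (u : ℂ) : ℕ := (analyticOrderAt fzXi u).toNat

noncomputable def fzn (R : ℝ) : ℝ := ∑ᶠ u ∈ {u | fzXi u = 0 ∧ ‖u‖ ≤ R}, (fzOrd u : ℝ)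

noncomputable def fzJ (R : ℝ) : ℝ := circleAverage (fun z => Real.log ‖fzXi z‖) 0 R

lemma fzXi_zero_ne : fzXi 0 ≠ 0 := by rw [fzXi_zero]; exact one_ne_zero

lemma fzZ_finite (R : ℝ) : {u | fzXi u = 0 ∧ ‖u‖ ≤ R}.Finite := by
  have := fz_zeros_finite fzXi_differentiable fzXi_zero_ne R
  simpa using this

lemma fzn_eq {R R' : ℝ} (h : R ≤ R') :
    fzn R = ∑ u ∈ (fzZ_finite R').toFinset, if ‖u‖ ≤ R then (fzOrd u : ℝ) else 0 := by
  rw [fzn, finsum_mem_eq_finite_toFinset_sum _ (fzZ_finite R), ← Finset.sum_filter]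
  refine Finset.sum_congr ?_ fun _ _ => rfl
  ext u
  simp only [Finite.mem_toFinset, mem_ofPred_eq, Finset.mem_filter]
  constructor
  · rintro ⟨h1, h2⟩
    exact ⟨⟨h1, h2.trans h⟩, h2⟩
  · rintro ⟨⟨h1, _⟩, h2⟩
    exact ⟨h1, h2⟩

lemma fzJ_eq {R R' : ℝ} (hR : 0 < R) (h : R ≤ R') :
    fzJ R = ∑ u ∈ (fzZ_finite R').toFinset, (fzOrd u : ℝ) * Real.posLog (R / ‖u‖) := by
  rw [fzJ, fz_jensen fzXi_differentiable fzXi_zero_ne hR (fzZ_finite R').toFinset]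
  · simp [fzXi_zero, fzOrd]
  · simp +contextual
  · intro u h1 h2
    rw [sub_zero] at h2
    simpa using ⟨h1, h2.trans h⟩

lemma fzXi_root_norm_pos {u : ℂ} (h : fzXi u = 0) : 0 < ‖u‖ := by
  rw [norm_pos_iff]
  rintro rfl
  exact fzXi_zero_ne h

lemma fz_posLog {x : ℝ} (hx : 1 ≤ x) : Real.posLog x = Real.log x :=
  Real.posLog_eq_log (by rwa [abs_of_pos (by linarith)])

lemma fz_posLog0 {x : ℝ} (hx0 : 0 ≤ x) (hx : x ≤ 1) : Real.posLog x = 0 :=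
  (Real.posLog_eq_zero_iff _).2 (by rwa [abs_of_nonneg hx0])

lemma fzn_lower {R R' : ℝ} (hR : 0 < R) (h : R ≤ R') :
    fzn R * Real.log (R' / R) ≤ fzJ R' - fzJ R := by
  have hR' : 0 < R' := hR.trans_le h
  rw [fzn_eq h, fzJ_eq hR h, fzJ_eq hR' le_rfl, ← Finset.sum_sub_distrib, Finset.sum_mul]
  refine Finset.sum_le_sum fun u hu => ?_
  have hu : fzXi u = 0 ∧ ‖u‖ ≤ R' := by simpa using hu
  have hp := fzXi_root_norm_pos hu.1
  rw [← mul_sub]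
  split_ifs with h1
  · refine mul_le_mul_of_nonneg_left ?_ (Nat.cast_nonneg _)
    rw [fz_posLog ((one_le_div hp).2 h1), fz_posLog ((one_le_div hp).2 hu.2),
      Real.log_div hR'.ne' hR.ne', Real.log_div hR'.ne' hp.ne', Real.log_div hR.ne' hp.ne']
    linarith
  · rw [zero_mul, fz_posLog0 (x := R / ‖u‖) (by positivity) ((div_le_one hp).2 (not_le.1 h1).le), sub_zero]
    exact mul_nonneg (Nat.cast_nonneg _) Real.posLog_nonneg

lemma fzn_upper {R R' : ℝ} (hR : 0 < R) (h : R ≤ R') :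
    fzJ R' - fzJ R ≤ fzn R' * Real.log (R' / R) := by
  have hR' : 0 < R' := hR.trans_le h
  rw [fzn_eq le_rfl, fzJ_eq hR h, fzJ_eq hR' le_rfl, ← Finset.sum_sub_distrib, Finset.sum_mul]
  refine Finset.sum_le_sum fun u hu => ?_
  have hu : fzXi u = 0 ∧ ‖u‖ ≤ R' := by simpa using hu
  have hp := fzXi_root_norm_pos hu.1
  rw [← mul_sub, if_pos hu.2]
  refine mul_le_mul_of_nonneg_left ?_ (Nat.cast_nonneg _)
  rw [fz_posLog ((one_le_div hp).2 hu.2)]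
  by_cases h1 : ‖u‖ ≤ R
  · rw [fz_posLog ((one_le_div hp).2 h1), 
      Real.log_div hR'.ne' hR.ne', Real.log_div hR'.ne' hp.ne', Real.log_div hR.ne' hp.ne']
    linarith
  · rw [fz_posLog0 (x := R / ‖u‖) (by positivity) ((div_le_one hp).2 (not_le.1 h1).le), sub_zero]
    apply Real.log_le_log (by positivity)
    have := (not_le.1 h1).le
    gcongr

lemma fz_tauber : Tendsto (fun R => fzn R / (R * Real.log R)) atTop (nhds (1 / π)) := by
  obtain ⟨C1, hC1, hup⟩ := fz_J_upper
  obtain ⟨C2, hC2, hlo⟩ := fz_J_lower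
  change ∀ R, 2 ≤ R → fzJ R ≤ _ at hup
  change ∀ R, 200 ≤ R → _ ≤ fzJ R at hlo
  have hpi := Real.pi_pos
  have hU : ∀ l : ℝ, 1 < l → ∀ᶠ R in atTop, fzn R / (R * Real.log R) ≤ l / π +
      ((l * Real.log l / π + C1 * l + C2) / Real.log l) / Real.log R := by
    intro l hl
    filter_upwards [eventually_ge_atTop 200] with R hR
    have hll : 0 < Real.log l := Real.log_pos hl
    have hlR : 0 < Real.log R := Real.log_pos (by linarith)
    have h1 := fzn_lower (R := R) (R' := l * R) (by linarith) (by nlinarith)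
    rw [mul_div_assoc, div_self (by linarith), mul_one] at h1
    have h2 := hup (l * R) (by nlinarith)
    have h3 := hlo R hR
    rw [Real.log_mul (by linarith) (by linarith)] at h2
    have h4 : fzn R * Real.log l ≤ (l - 1) * (R * Real.log R) / π +
        (l * Real.log l / π + C1 * l + C2) * R := by
      refine (h1.trans (sub_le_sub h2 h3)).trans (le_of_eq ?_)
      ring
    have h5 : l - 1 ≤ l * Real.log l := by
      have := Real.one_sub_inv_le_log_of_pos (by linarith : 0 < l)
      have h6 : l * (1 - l⁻¹) ≤ l * Real.log l := by gcongr
      rwa [mul_sub, mul_one, mul_inv_cancel₀ (by linarith)] at h6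
    rw [div_le_iff₀ (by positivity)]
    have h7 : fzn R * Real.log l ≤ (l / π + ((l * Real.log l / π + C1 * l + C2) / Real.log l) / Real.log R) *
        (R * Real.log R) * Real.log l := by
      refine h4.trans ?_
      have e : (l / π + ((l * Real.log l / π + C1 * l + C2) / Real.log l) / Real.log R) *
        (R * Real.log R) * Real.log l = (l * Real.log l) * (R * Real.log R) / π +
          (l * Real.log l / π + C1 * l + C2) * R := by
        field_simp
      rw [e]
      gcongr
    exact le_of_mul_le_mul_right h7 hll
  have hL : ∀ l : ℝ, 1 < l → ∀ᶠ R in atTop, 1 / (l * π) - 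
      ((C1 + C2) / Real.log l) / Real.log R ≤ fzn R / (R * Real.log R) := by
    intro l hl
    filter_upwards [eventually_ge_atTop (200 * l)] with R hR
    have hl0 : 0 < l := by linarith
    have hR2 : 200 < R := by nlinarith
    have hll : 0 < Real.log l := Real.log_pos hl
    have hlR : 0 < Real.log R := Real.log_pos (by linarith)
    have hdl : 200 ≤ R / l := by rwa [le_div_iff₀ hl0]
    have h1 := fzn_upper (R := R / l) (R' := R) (by linarith) (div_le_self (by linarith) hl.le)
    rw [div_div_cancel₀ (by linarith)] at h1
    have h2 := hup (R / l) (by linarith)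
    have h3 := hlo R (by linarith)
    have h2' : fzJ (R / l) ≤ (R / l) * Real.log R / π + C1 * R := by
      refine h2.trans ?_
      have a : R / l ≤ R := div_le_self (by linarith) hl.le
      gcongr
    have h4 : (1 - l⁻¹) * (R * Real.log R) / π - (C1 + C2) * R ≤ fzn R * Real.log l := by
      refine le_trans (le_of_eq ?_) ((sub_le_sub h3 h2').trans h1)
      ring
    have h5 : l⁻¹ * Real.log l ≤ 1 - l⁻¹ := by
      have := Real.log_le_sub_one_of_pos hl0
      have h6 : l⁻¹ * Real.log l ≤ l⁻¹ * (l - 1) := by gcongr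
      rwa [mul_sub, mul_one, inv_mul_cancel₀ (by linarith)] at h6
    rw [le_div_iff₀ (by positivity)]
    have h7 : (1 / (l * π) - ((C1 + C2) / Real.log l) / Real.log R) *
        (R * Real.log R) * Real.log l ≤ fzn R * Real.log l := by
      refine le_trans ?_ h4
      have e : (1 / (l * π) - ((C1 + C2) / Real.log l) / Real.log R) *
        (R * Real.log R) * Real.log l = (l⁻¹ * Real.log l) * (R * Real.log R) / π - (C1 + C2) * R := by
        field_simp
      rw [e]
      gcongr
    exact le_of_mul_le_mul_right h7 hll
  have hlim : ∀ A B : ℝ, Tendsto (fun R : ℝ => A + B / Real.log R) atTop (nhds A) := by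
    intro A B
    simpa using (tendsto_const_nhds (x := A)).add (Real.tendsto_log_atTop.const_div_atTop B)
  have hc1 : ContinuousAt (fun l : ℝ => 1 / (l * π)) 1 := by
    fun_prop (disch := simp)
  have hc2 : ContinuousAt (fun l : ℝ => l / π) 1 := by
    fun_prop
  rw [tendsto_order]
  constructor
  · intro a ha
    have h1 : ∀ᶠ l in nhdsWithin (1:ℝ) (Ioi 1), a < 1 / (l * π) :=
      (hc1.mono_left nhdsWithin_le_nhds).eventually_const_lt (by simpa using ha)
    obtain ⟨l, hl1, hl2⟩ := (h1.and self_mem_nhdsWithin).exists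
    have h2 := (hlim (1 / (l * π)) (-((C1 + C2) / Real.log l))).eventually_const_lt hl1
    filter_upwards [h2, hL l hl2] with R h3 h4
    refine h3.trans_le (le_trans (le_of_eq ?_) h4)
    ring
  · intro a ha
    have h1 : ∀ᶠ l in nhdsWithin (1:ℝ) (Ioi 1), l / π < a :=
      (hc2.mono_left nhdsWithin_le_nhds).eventually_lt_const (by simpa using ha)
    obtain ⟨l, hl1, hl2⟩ := (h1.and self_mem_nhdsWithin).exists
    have h2 := (hlim (l / π) ((l * Real.log l / π + C1 * l + C2) / Real.log l)).eventually_lt_const hl1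
    filter_upwards [h2, hU l hl2] with R h3 h4
    exact h4.trans_lt h3

lemma fzXi_ne_zero' {u : ℂ} (h : 1 ≤ u.re) : fzXi u ≠ 0 := by
  by_cases h1 : u = 1
  · have := fzXi_one_sub 0
    rw [sub_zero, fzXi_zero] at this
    rw [h1, this]
    exact one_ne_zero
  · have h0 : u ≠ 0 := by
      rintro rfl
      simp at h
      linarith
    rw [fzXi_eq_zeta (by linarith) h1]
    exact mul_ne_zero (mul_ne_zero (mul_ne_zero h0 (sub_ne_zero.2 h1))
      (Gammaℝ_ne_zero_of_re_pos (by linarith))) (riemannZeta_ne_zero_of_one_le_re h)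

lemma fzXi_eq_zero_iff (u : ℂ) : fzXi u = 0 ↔ riemannZeta u = 0 ∧ 0 < u.re ∧ u.re < 1 := by
  constructor
  · intro h
    have h1 : u.re < 1 := by
      by_contra h1
      exact fzXi_ne_zero' (not_lt.1 h1) h
    have h0 : 0 < u.re := by
      by_contra h0
      rw [← fzXi_one_sub] at h
      refine fzXi_ne_zero' ?_ h
      rw [sub_re, one_re]
      linarith
    have hu1 : u ≠ 1 := by rintro rfl; simp at h1
    have hu0 : u ≠ 0 := by rintro rfl; simp at h0
    rw [fzXi_eq_zeta h0 hu1] at h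
    have hg := Gammaℝ_ne_zero_of_re_pos h0
    have := sub_ne_zero.2 hu1
    simp_all
  · rintro ⟨h, h0, h1⟩
    have hu1 : u ≠ 1 := by rintro rfl; simp at h1
    rw [fzXi_eq_zeta h0 hu1, h, mul_zero]

lemma fz_analytic_zeta {u : ℂ} (hu1 : u ≠ 1) : AnalyticAt ℂ riemannZeta u := by
  have : DifferentiableOn ℂ riemannZeta {1}ᶜ := fun z hz =>
    (differentiableAt_riemannZeta hz).differentiableWithinAt
  exact this.analyticAt (isOpen_compl_singleton.mem_nhds hu1)

lemma fzOrd_eq {u : ℂ} (h0 : 0 < u.re) (h1 : u.re < 1) : fzOrd u = zetaZeroMult u := by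
  have hu1 : u ≠ 1 := by rintro rfl; simp at h1
  have hu0 : u ≠ 0 := by rintro rfl; simp at h0
  have hz := fz_analytic_zeta hu1
  rw [zetaZeroMult, dif_pos hz, fzOrd]
  congr 1
  have hopen : IsOpen {s : ℂ | 0 < s.re} := isOpen_lt continuous_const Complex.continuous_re
  have hg : AnalyticAt ℂ (fun s => s * (s - 1) * Gammaℝ s) u := by
    have hd : DifferentiableOn ℂ (fun s => s * (s - 1) * Gammaℝ s) {s : ℂ | 0 < s.re} := by
      intro s hs
      have hs : 0 < s.re := hs
      apply DifferentiableAt.differentiableWithinAt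
      have : DifferentiableAt ℂ Gammaℝ s := by
        have h3 := differentiable_Gammaℝ_inv s
        have h4 := h3.inv (inv_ne_zero (Gammaℝ_ne_zero_of_re_pos hs))
        have h5 : (fun s : ℂ => (Gammaℝ s)⁻¹)⁻¹ = Gammaℝ := by
          ext x
          simp
        rwa [h5] at h4
      fun_prop
    exact hd.analyticAt (hopen.mem_nhds h0)
  have hev : fzXi =ᶠ[nhds u] (fun s => s * (s - 1) * Gammaℝ s) * riemannZeta := by
    filter_upwards [hopen.mem_nhds h0, isOpen_compl_singleton.mem_nhds hu1] with s hs hs1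
    exact fzXi_eq_zeta hs hs1
  rw [analyticOrderAt_congr hev, analyticOrderAt_mul hg hz, hg.analyticOrderAt_eq_zero.2, zero_add]
  exact mul_ne_zero (mul_ne_zero hu0 (sub_ne_zero.2 hu1)) (Gammaℝ_ne_zero_of_re_pos h0)

lemma fzOrd_one_sub (u : ℂ) : fzOrd (1 - u) = fzOrd u := by
  unfold fzOrd
  congr 1
  have hf : AnalyticAt ℂ fzXi (1 - u) := fzXi_differentiable.analyticAt _
  have hg : AnalyticAt ℂ (fun z : ℂ => 1 - z) u := by fun_prop
  have := analyticOrderAt_comp_of_deriv_ne_zero (f := fzXi) hg (by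
    rw [deriv_const_sub]
    simp) 
  rw [← this]
  congr 1
  ext z
  exact fzXi_one_sub z

lemma fzA_sub {T : ℝ} (hT : 0 ≤ T) {u : ℂ} (h1 : fzXi u = 0) (h2 : |u.im| ≤ T) : ‖u‖ ≤ T + 1 := by
  obtain ⟨_, h3, h4⟩ := (fzXi_eq_zero_iff u).1 h1
  have := Complex.norm_le_abs_re_add_abs_im u
  rw [abs_of_pos h3] at this
  linarith

lemma fzA_finite (T : ℝ) : {u | fzXi u = 0 ∧ |u.im| ≤ T}.Finite := by
  by_cases hT : 0 ≤ T
  · exact (fzZ_finite (T + 1)).subset fun u hu => ⟨hu.1, fzA_sub hT hu.1 hu.2⟩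
  · convert Set.finite_empty (α := ℂ) using 1
    ext u
    have := abs_nonneg u.im
    simp only [mem_ofPred_eq, mem_empty_iff_false, iff_false]
    rintro ⟨_, h⟩
    linarith

lemma zetaN_eq (T : ℝ) : (zetaN T : ℝ) =
    ∑ u ∈ (fzA_finite T).toFinset, if 0 < u.im then (fzOrd u : ℝ) else 0 := by
  rw [← Finset.sum_filter, zetaN]
  have hS : zetaZerosUpTo T =
      ((fzA_finite T).toFinset.filter fun u => 0 < u.im : Finset ℂ) := by
    ext u
    simp only [zetaZerosUpTo, mem_ofPred_eq, Finset.coe_filter, Finite.mem_toFinset, fzXi_eq_zero_iff]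
    constructor
    · rintro ⟨a, b, c, d, e⟩
      exact ⟨⟨⟨a, b, c⟩, by rwa [abs_of_pos d]⟩, d⟩
    · rintro ⟨⟨⟨a, b, c⟩, e⟩, d⟩
      rw [abs_of_pos d] at e
      exact ⟨a, b, c, d, e⟩
  rw [hS, finsum_mem_coe_finset]
  push_cast
  refine Finset.sum_congr rfl fun u hu => ?_
  simp only [Finset.mem_filter, Finite.mem_toFinset, mem_ofPred_eq, fzXi_eq_zero_iff] at hu
  rw [fzOrd_eq hu.1.1.2.1 hu.1.1.2.2]

lemma zetaN_eq' (T : ℝ) : (zetaN T : ℝ) =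
    ∑ u ∈ (fzA_finite T).toFinset, if u.im < 0 then (fzOrd u : ℝ) else 0 := by
  rw [zetaN_eq]
  refine Finset.sum_nbij' (fun u => 1 - u) (fun u => 1 - u) ?_ ?_ ?_ ?_ ?_
  · intro u hu
    simpa [fzXi_one_sub] using hu
  · intro u hu
    simpa [fzXi_one_sub] using hu
  · simp
  · simp
  · intro u hu
    simp [fzOrd_one_sub]

lemma zetaN_bounds {T : ℝ} (hT : 0 ≤ T) :
    fzn T - fzn 1 ≤ 2 * (zetaN T : ℝ) ∧ 2 * (zetaN T : ℝ) ≤ fzn (T + 1) := by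
  have hsum : ∑ u ∈ (fzA_finite T).toFinset, (fzOrd u : ℝ) = 2 * (zetaN T : ℝ) +
      ∑ u ∈ (fzA_finite T).toFinset, if u.im = 0 then (fzOrd u : ℝ) else 0 := by
    rw [two_mul]
    nth_rewrite 1 [zetaN_eq]
    rw [zetaN_eq', ← Finset.sum_add_distrib, ← Finset.sum_add_distrib]
    refine Finset.sum_congr rfl fun u _ => ?_
    rcases lt_trichotomy u.im 0 with h | h | h
    · simp [h, h.ne, h.le]
    · simp [h]
    · simp [h, h.ne', h.le]
  have h0 : 0 ≤ ∑ u ∈ (fzA_finite T).toFinset, if u.im = 0 then (fzOrd u : ℝ) else 0 :=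
    Finset.sum_nonneg fun u _ => by split_ifs <;> simp
  have h1 : ∑ u ∈ (fzA_finite T).toFinset, (if u.im = 0 then (fzOrd u : ℝ) else 0) ≤ fzn 1 := by
    rw [← Finset.sum_filter, fzn, finsum_mem_eq_finite_toFinset_sum _ (fzZ_finite 1)]
    refine Finset.sum_le_sum_of_subset_of_nonneg ?_ fun _ _ _ => Nat.cast_nonneg _
    intro u hu
    simp only [Finset.mem_filter, Finite.mem_toFinset, mem_ofPred_eq] at hu ⊢
    have := fzA_sub le_rfl hu.1.1 (by rw [hu.2]; simp)
    exact ⟨hu.1.1, by linarith⟩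
  have h2 : fzn T ≤ ∑ u ∈ (fzA_finite T).toFinset, (fzOrd u : ℝ) := by
    rw [fzn, finsum_mem_eq_finite_toFinset_sum _ (fzZ_finite T)]
    refine Finset.sum_le_sum_of_subset_of_nonneg ?_ fun _ _ _ => Nat.cast_nonneg _
    intro u hu
    simp only [Finite.mem_toFinset, mem_ofPred_eq] at hu ⊢
    exact ⟨hu.1, (Complex.abs_im_le_norm u).trans hu.2⟩
  have h3 : ∑ u ∈ (fzA_finite T).toFinset, (fzOrd u : ℝ) ≤ fzn (T + 1) := by
    rw [fzn, finsum_mem_eq_finite_toFinset_sum _ (fzZ_finite (T + 1))]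
    refine Finset.sum_le_sum_of_subset_of_nonneg ?_ fun _ _ _ => Nat.cast_nonneg _
    intro u hu
    simp only [Finite.mem_toFinset, mem_ofPred_eq] at hu ⊢
    exact ⟨hu.1, fzA_sub hT hu.1 hu.2⟩
  constructor <;> linarith

lemma fz_shift : Tendsto (fun T : ℝ => ((T + 1) * Real.log (T + 1)) / (T * Real.log T)) atTop (nhds 1) := by
  have h1 : Tendsto (fun T : ℝ => 1 + 1 / T) atTop (nhds 1) := by
    simpa using (tendsto_const_nhds (x := (1:ℝ))).add (tendsto_id.const_div_atTop (1:ℝ))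
  have h2 : Tendsto (fun T : ℝ => 1 + Real.log (1 + 1 / T) / Real.log T) atTop (nhds 1) := by
    have h3 : Tendsto (fun T : ℝ => Real.log (1 + 1 / T)) atTop (nhds 0) := by
      simpa using h1.log one_ne_zero
    simpa using (tendsto_const_nhds (x := (1:ℝ))).add (h3.div_atTop Real.tendsto_log_atTop)
  have h4 := h1.mul h2
  rw [mul_one] at h4
  refine h4.congr' ?_
  filter_upwards [eventually_gt_atTop 2] with T hT
  have hl : 0 < Real.log T := Real.log_pos (by linarith)
  have hT0 : 0 < T := by linarith
  have e : T + 1 = T * (1 + 1 / T) := by field_simp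
  have e2 : Real.log (T + 1) = Real.log T + Real.log (1 + 1 / T) := by
    rw [e, Real.log_mul hT0.ne' (by positivity)]
  rw [e2]
  field_simp

lemma zetaN_asymp : Tendsto (fun T : ℝ => (zetaN T : ℝ) / (T * Real.log T)) atTop
    (nhds (1 / (2 * π))) := by
  have h1 := fz_tauber
  have h2 := (h1.comp (tendsto_atTop_add_const_right atTop (1:ℝ) tendsto_id)).mul fz_shift
  have h0 : Tendsto (fun T : ℝ => fzn 1 / (T * Real.log T)) atTop (nhds 0) :=
    (tendsto_id.atTop_mul_atTop₀ Real.tendsto_log_atTop).const_div_atTop _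
  have h3 := (h1.sub h0).div_const 2
  have h4 := h2.div_const 2
  have e1 : (1 / π - 0) / 2 = 1 / (2 * π) := by rw [sub_zero, div_div, mul_comm]
  have e2 : (1 / π * 1) / 2 = 1 / (2 * π) := by rw [mul_one, div_div, mul_comm]
  rw [e1] at h3
  rw [e2] at h4
  refine tendsto_of_tendsto_of_tendsto_of_le_of_le' h3 h4 ?_ ?_
  · filter_upwards [eventually_gt_atTop 2] with T hT
    have hl : 0 < Real.log T := Real.log_pos (by linarith)
    have hb := (zetaN_bounds (T := T) (by linarith)).1
    rw [← sub_div, div_div, div_le_div_iff₀ (by positivity) (by positivity)]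
    have : 0 ≤ T * Real.log T := by positivity
    nlinarith
  · filter_upwards [eventually_gt_atTop 2] with T hT
    have hl : 0 < Real.log T := Real.log_pos (by linarith)
    have hl1 : 0 < Real.log (T + 1) := Real.log_pos (by linarith)
    have hb := (zetaN_bounds (T := T) (by linarith)).2
    simp only [Function.comp_apply, id]
    have e : fzn (T + 1) / ((T + 1) * Real.log (T + 1)) * ((T + 1) * Real.log (T + 1) / (T * Real.log T)) / 2
      = fzn (T + 1) / 2 / (T * Real.log T) := by
      field_simp
    rw [e]
    gcongr
    linarith

lemma fz_final {α : ℝ} {G : ℝ → ℝ} {S : ℝ}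
    (hconv : TendstoUniformlyOn (fun (T : ℝ) (y : ℝ) => Mfun α y T) G atTop (Set.Icc 0 1))
    (hS : ∀ y ∈ Set.Icc (0:ℝ) 1, |G y| ≤ S) (y0 : ℝ) (hy0 : y0 ∈ Set.Icc (0:ℝ) 1)
    (hS0 : S ≤ |G y0|) :
    Tendsto (fun T : ℝ => Dstar α T * Real.log T) atTop (nhds (2 * π * S)) := by
  have hm : Tendsto (fun T : ℝ => sSup ((fun y => |Mfun α y T|) '' Set.Icc (0:ℝ) 1)) atTop (nhds S) := by
    rw [Metric.tendsto_nhds]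
    intro ε hε
    filter_upwards [Metric.tendstoUniformlyOn_iff.1 hconv (ε / 2) (by positivity)] with T hT
    have hub : ∀ x ∈ ((fun y => |Mfun α y T|) '' Set.Icc (0:ℝ) 1), x ≤ S + ε / 2 := by
      rintro _ ⟨y, hy, rfl⟩
      have h1 := hT y hy
      rw [Real.dist_eq, abs_sub_comm] at h1
      have h2 := abs_sub_abs_le_abs_sub (Mfun α y T) (G y)
      have h3 := hS y hy
      dsimp only
      linarith
    have hle : sSup ((fun y => |Mfun α y T|) '' Set.Icc (0:ℝ) 1) ≤ S + ε / 2 :=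
      csSup_le ⟨_, ⟨y0, hy0, rfl⟩⟩ hub
    have hge : |Mfun α y0 T| ≤ sSup ((fun y => |Mfun α y T|) '' Set.Icc (0:ℝ) 1) :=
      le_csSup ⟨_, hub⟩ ⟨y0, hy0, rfl⟩
    have h1 := hT y0 hy0
    rw [Real.dist_eq] at h1
    have h2 := abs_sub_abs_le_abs_sub (G y0) (Mfun α y0 T)
    rw [Real.dist_eq, abs_lt]
    constructor <;> linarith
  have hN : Tendsto (fun T : ℝ => T / (zetaN T : ℝ) * Real.log T) atTop (nhds (2 * π)) := by
    have h := zetaN_asymp.inv₀ (by positivity)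
    rw [one_div, inv_inv] at h
    refine h.congr fun T => ?_
    rw [inv_div, mul_div_right_comm]
  refine (hN.mul hm).congr' ?_
  filter_upwards [eventually_ge_atTop 0] with T hT
  have h0 : 0 ≤ T / (zetaN T : ℝ) := by positivity
  have : Dstar α T = T / (zetaN T : ℝ) * sSup ((fun y => |Mfun α y T|) '' Set.Icc (0:ℝ) 1) := by
    rw [Dstar, ← smul_eq_mul, ← Real.sSup_smul_of_nonneg h0]
    congr 1
    rw [← Set.image_smul, Set.image_image]
    rfl
  rw [this]
  ring

lemma fz_integral {X L : ℝ} (hX : 1 < X) {q : ℕ} (hq : 0 < q) (y : ℝ) :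
    ∫ t in (0:ℝ)..y, -((X * Real.cos (2 * π * q * t) - 1) * L) /
      (π * (X ^ 2 - 2 * X * Real.cos (2 * π * q * t) + 1)) =
    -(L / (2 * π ^ 2 * q)) * Real.arctan (Real.sin (2 * π * q * y) / (X - Real.cos (2 * π * q * y))) := by
  have hden : ∀ t : ℝ, 0 < X - Real.cos t := fun t => by linarith [Real.cos_le_one t]
  have hden2 : ∀ t : ℝ, 0 < X ^ 2 - 2 * X * Real.cos t + 1 := fun t => by
    nlinarith [Real.cos_le_one t]
  have hq' : (0:ℝ) < q := by exact_mod_cast hq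
  rw [intervalIntegral.integral_eq_sub_of_hasDerivAt (f := fun y => -(L / (2 * π ^ 2 * q)) *
    Real.arctan (Real.sin (2 * π * q * y) / (X - Real.cos (2 * π * q * y))))]
  · simp
  · intro t _
    have hl : HasDerivAt (fun t : ℝ => 2 * π * q * t) (2 * π * q) t := by
      simpa using (hasDerivAt_id t).const_mul (2 * π * q)
    have hs := hl.sin
    have hc := hl.cos.const_sub X
    have h := ((hs.div hc (hden _).ne').arctan).const_mul (-(L / (2 * π ^ 2 * q)))
    refine HasDerivAt.congr_deriv h ?_
    simp only [Pi.div_apply]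
    have e := Real.sin_sq_add_cos_sq (2 * π * q * t)
    set c := Real.cos (2 * π * q * t) with hcdef
    set s := Real.sin (2 * π * q * t) with hsdef
    have h1 : 0 < X - c := hden _
    have h2 : 0 < X ^ 2 - 2 * X * c + 1 := hden2 _
    have h3 : 1 + (s / (X - c)) ^ 2 = (X ^ 2 - 2 * X * c + 1) / (X - c) ^ 2 := by
      field_simp
      nlinarith
    rw [h3]
    have h4 : c * (2 * π * ↑q) * (X - c) - s * (- (-s * (2 * π * q))) = 2 * π * q * (X * c - 1) := by
      linear_combination (-(2 * π * q)) * e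
    rw [h4]
    have hpi := Real.pi_pos
    field_simp
  · apply Continuous.intervalIntegrable
    apply Continuous.div (by fun_prop) (by fun_prop)
    intro t
    have := hden2 (2 * π * q * t)
    positivity

lemma fz_arctan_bound {X : ℝ} (hX : 1 < X) (φ : ℝ) :
    |Real.arctan (Real.sin φ / (X - Real.cos φ))| ≤ Real.arcsin X⁻¹ := by
  have hX0 : 0 < X := by linarith
  have hr1 : X⁻¹ < 1 := inv_lt_one_of_one_lt₀ hX
  have hr0 : 0 < X⁻¹ := by positivity
  rw [Real.arcsin_eq_arctan ⟨by linarith, hr1⟩]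
  have hden : 0 < X - Real.cos φ := by linarith [Real.cos_le_one φ]
  have hsq : 0 < 1 - X⁻¹ ^ 2 := by nlinarith
  have hs := Real.sqrt_pos.2 hsq
  have hss := Real.sq_sqrt hsq.le
  set w := √(1 - X⁻¹ ^ 2) with hw
  have key : |Real.sin φ / (X - Real.cos φ)| ≤ X⁻¹ / w := by
    rw [abs_div, abs_of_pos hden, div_le_div_iff₀ hden hs]
    have e := Real.sin_sq_add_cos_sq φ
    have e2 := sq_abs (Real.sin φ)
    have hx : X⁻¹ * X = 1 := inv_mul_cancel₀ hX0.ne'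
    have h1 : (|Real.sin φ| * w + X⁻¹ * Real.cos φ) ^ 2 ≤ 1 := by
      nlinarith [sq_nonneg (|Real.sin φ| * X⁻¹ - w * Real.cos φ)]
    have h2 : |Real.sin φ| * w + X⁻¹ * Real.cos φ ≤ 1 := by
      nlinarith
    rw [mul_sub, hx]
    linarith
  rw [abs_le] at key ⊢
  rw [← Real.arctan_neg]
  exact ⟨Real.arctan_strictMono.monotone key.1, Real.arctan_strictMono.monotone key.2⟩

lemma fz_arctan_eq {X : ℝ} (hX : 1 < X) :
    Real.arctan (Real.sin (Real.arccos X⁻¹) / (X - Real.cos (Real.arccos X⁻¹))) = Real.arcsin X⁻¹ := by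
  have hX0 : 0 < X := by linarith
  have hr1 : X⁻¹ < 1 := inv_lt_one_of_one_lt₀ hX
  have hr0 : 0 < X⁻¹ := by positivity
  rw [Real.arcsin_eq_arctan ⟨by linarith, hr1⟩, Real.sin_arccos, Real.cos_arccos (by linarith) hr1.le]
  have hsq : 0 < 1 - X⁻¹ ^ 2 := by nlinarith
  have hs := Real.sqrt_pos.2 hsq
  have hss := Real.sq_sqrt hsq.le
  have hx : X⁻¹ * X = 1 := inv_mul_cancel₀ hX0.ne'
  congr 1
  rw [div_eq_div_iff (by linarith) hs.ne']
  linear_combination hss - hx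
/-- Corollary 5 of Ford–Zaharescu (consequence of Conjecture A). -/
theorem ford_zaharescu_conj3 (α : ℝ) (hα : 0 < α) (g : ℝ → ℝ) (hg : IsDensityOf α g)
    (hconv : TendstoUniformlyOn (fun (T : ℝ) (y : ℝ) => Mfun α y T)
      (fun y => ∫ t in (0:ℝ)..y, g t) Filter.atTop (Set.Icc 0 1)) :
    (∀ p a q : ℕ, IsSpecialForm α p a q →
      Filter.Tendsto (fun T : ℝ => Dstar α T * Real.log T) Filter.atTop
        (nhds (Real.log p / (π * q) * Real.arcsin ((p : ℝ) ^ (-(a : ℝ) / 2))))) ∧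
    ((¬ ∃ p a q : ℕ, IsSpecialForm α p a q) →
      Filter.Tendsto (fun T : ℝ => Dstar α T * Real.log T) Filter.atTop (nhds 0)) := by
  constructor
  · intro p a q hs
    have hgg := hg.1 p a q hs
    obtain ⟨hp, ha, hq, -, -⟩ := hs
    have hp1 : (1:ℝ) < p := by exact_mod_cast hp.one_lt
    have ha' : (0:ℝ) < a := by exact_mod_cast ha
    have hq' : (1:ℝ) ≤ q := by exact_mod_cast hq
    have hpi := Real.pi_pos
    have hX : 1 < (p:ℝ) ^ ((a:ℝ) / 2) := Real.one_lt_rpow hp1 (by positivity)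
    have hX2 : (p:ℝ) ^ (a:ℝ) = ((p:ℝ) ^ ((a:ℝ) / 2)) ^ 2 := by
      rw [← Real.rpow_natCast, ← Real.rpow_mul (by linarith)]
      congr 1
      push_cast
      ring
    have hXi : (p:ℝ) ^ (-(a:ℝ) / 2) = ((p:ℝ) ^ ((a:ℝ) / 2))⁻¹ := by
      rw [neg_div, Real.rpow_neg (by linarith)]
    have hgy : ∀ y, ∫ t in (0:ℝ)..y, g t = -(Real.log p / (2 * π ^ 2 * q)) *
        Real.arctan (Real.sin (2 * π * q * y) /
          ((p:ℝ) ^ ((a:ℝ) / 2) - Real.cos (2 * π * q * y))) := by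
      intro y
      rw [← fz_integral hX hq, hgg]
      unfold gPAQ
      rw [hX2]
    simp_rw [hgy] at hconv
    rw [hXi]
    set X := (p:ℝ) ^ ((a:ℝ) / 2) with hXdef
    have hL : 0 < Real.log p := Real.log_pos hp1
    have hcoef : 0 ≤ Real.log p / (2 * π ^ 2 * q) := by positivity
    have e : Real.log p / (π * q) * Real.arcsin X⁻¹ =
        2 * π * (Real.log p / (2 * π ^ 2 * q) * Real.arcsin X⁻¹) := by
      field_simp
    rw [e]
    have hX0 : 0 < X⁻¹ := by positivity
    refine fz_final hconv ?_ (Real.arccos X⁻¹ / (2 * π * q)) ?_ ?_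
    · intro y _
      rw [abs_mul, abs_neg, abs_of_nonneg hcoef]
      exact mul_le_mul_of_nonneg_left (fz_arctan_bound hX _) hcoef
    · refine ⟨div_nonneg (Real.arccos_nonneg _) (by positivity), ?_⟩
      rw [div_le_one (by positivity)]
      have := Real.arccos_le_pi X⁻¹
      nlinarith
    · rw [abs_mul, abs_neg, abs_of_nonneg hcoef, mul_div_cancel₀ _ (by positivity), fz_arctan_eq hX]
      exact mul_le_mul_of_nonneg_left (le_abs_self _) hcoef
  · intro h
    have hg0 := hg.2 h
    subst hg0
    have := fz_final (S := 0) hconv (by simp) 0 (by simp) (by simp)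
    simpa using this
end

section
/- Let a₁, a₂, … be an arbitrary sequence of points of the torus 𝕋 = ℝ/ℤ, let t be a point of 𝕋, and let f : ℝ → ℝ be a function decreasing monotonically to 0. Then there exists a function h : 𝕋 → ℝ which is continuous and differentiable on 𝕋 and infinitely differentiable on 𝕋 \ {t}, such that |(1/n) ∑_{j=1}^n h(a_j) − ∫_𝕋 h| ≥ f(n) for infinitely many positive integers n. -/
open Filter MeasureTheory Real Complex Set

namespace FZ

noncomputable def g (t x : ℝ) : ℝ := Real.sin (π * (x - t)) ^ 2

lemma g_nonneg (t x : ℝ) : 0 ≤ g t x := sq_nonneg _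

lemma g_periodic (t : ℝ) : Function.Periodic (g t) 1 := by
  intro x
  have : π * (x + 1 - t) = π * (x - t) + π := by ring
  simp [g, this, Real.sin_add_pi]

lemma g_smooth (t : ℝ) : ContDiff ℝ (⊤ : ℕ∞) (g t) := by
  unfold g; fun_prop

lemma g_pos_of (t x : ℝ) (h : ∀ k : ℤ, x - t ≠ k) : 0 < g t x := by
  apply pow_pos_of_ne
  intro h0
  obtain ⟨k, hk⟩ := Real.sin_eq_zero_iff.1 h0
  apply h k
  have : π * (k - (x - t)) = 0 := by linarith
  rcases mul_eq_zero.1 this with h1 | h1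
  · exact absurd h1 Real.pi_ne_zero
  · linarith
where
  pow_pos_of_ne {y : ℝ} (hy : y ≠ 0) : 0 < y ^ 2 := by positivity

/-- bump near t -/
noncomputable def B (t : ℝ) (k : ℕ) (x : ℝ) : ℝ :=
  (1 / 2 : ℝ) ^ (k + 1) * (g t x * Real.smoothTransition (1 / ((k : ℝ) + 1) - g t x))

lemma B_smooth (t : ℝ) (k : ℕ) : ContDiff ℝ (⊤ : ℕ∞) (B t k) := by
  unfold B
  have h1 := g_smooth t
  have h2 : ContDiff ℝ (⊤ : ℕ∞) Real.smoothTransition := Real.smoothTransition.contDiff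
  exact contDiff_const.mul (h1.mul (h2.comp (contDiff_const.sub h1)))

lemma B_nonneg (t : ℝ) (k : ℕ) (x : ℝ) : 0 ≤ B t k x := by
  unfold B
  have := g_nonneg t x
  have := Real.smoothTransition.nonneg (1 / ((k : ℝ) + 1) - g t x)
  positivity

lemma B_le (t : ℝ) (k : ℕ) (x : ℝ) : B t k x ≤ (1 / 2 : ℝ) ^ (k + 1) * g t x := by
  unfold B
  have := g_nonneg t x
  have := Real.smoothTransition.le_one (1 / ((k : ℝ) + 1) - g t x)
  gcongr
  exact mul_le_of_le_one_right ‹_› this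

lemma B_int_pos (t : ℝ) (k : ℕ) : 0 < ∫ u in (0:ℝ)..1, B t k u := by
  have hp : Function.Periodic (B t k) 1 := by
    intro x; simp [B, g_periodic t x]
  have e : ∫ u in (0:ℝ)..1, B t k u = ∫ u in t..(t+1), B t k u := by
    have := hp.intervalIntegral_add_eq 0 t
    simpa using this
  rw [e]
  have hev : ∀ᶠ x in nhds t, g t x < 1 / ((k : ℝ) + 1) := by
    have hc : Tendsto (g t) (nhds t) (nhds (g t t)) := (g_smooth t).continuous.continuousAt
    have : g t t = 0 := by simp [g]
    rw [this] at hc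
    exact hc.eventually_lt_const (by positivity)
  have hev2 : ∀ᶠ x in nhdsWithin t (Ioi t), g t x < 1 / ((k : ℝ) + 1) ∧ x < t + 1 ∧ t < x := by
    refine (hev.filter_mono nhdsWithin_le_nhds).and (Filter.Eventually.and ?_ self_mem_nhdsWithin)
    exact (eventually_lt_nhds (by linarith)).filter_mono nhdsWithin_le_nhds
  obtain ⟨x, h1, h2, h3⟩ := hev2.exists
  refine intervalIntegral.integral_pos (by linarith) (B_smooth t k).continuous.continuousOn
    (fun y _ => B_nonneg t k y) ⟨x, ⟨h3.le, h2.le⟩, ?_⟩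
  have hg : 0 < g t x := by
    have : 0 < Real.sin (π * (x - t)) := by
      apply Real.sin_pos_of_pos_of_lt_pi
      · have := Real.pi_pos; have : 0 < x - t := by linarith
        positivity
      · have := Real.pi_pos; nlinarith
    unfold g; positivity
  have := Real.smoothTransition.pos_of_pos (x := 1 / ((k : ℝ) + 1) - g t x) (by linarith)
  unfold B; positivity

noncomputable def R (a : ℕ → ℝ) (n m : ℕ) (x : ℝ) : ℝ :=
  ∏ j ∈ Finset.range n, (1 - (1 - g (a j) x) ^ m)

lemma g_le_one (t x : ℝ) : g t x ≤ 1 := by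
  unfold g; nlinarith [Real.sin_sq_add_cos_sq (π * (x - t)), sq_nonneg (Real.cos (π * (x - t)))]

lemma R_nonneg (a : ℕ → ℝ) (n m : ℕ) (x : ℝ) : 0 ≤ R a n m x := by
  apply Finset.prod_nonneg
  intro j _
  have := pow_le_one₀ (n := m) (sub_nonneg.2 (g_le_one (a j) x)) (by linarith [g_nonneg (a j) x])
  linarith

lemma R_le_one (a : ℕ → ℝ) (n m : ℕ) (x : ℝ) : R a n m x ≤ 1 := by
  apply Finset.prod_le_one
  · intro j _
    have := pow_le_one₀ (n := m) (sub_nonneg.2 (g_le_one (a j) x)) (by linarith [g_nonneg (a j) x])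
    linarith
  · intro j _
    have := pow_nonneg (sub_nonneg.2 (g_le_one (a j) x)) m
    linarith

lemma R_smooth (a : ℕ → ℝ) (n m : ℕ) : ContDiff ℝ (⊤ : ℕ∞) (R a n m) := by
  unfold R
  apply contDiff_prod
  intro j _
  exact contDiff_const.sub ((contDiff_const.sub (g_smooth (a j))).pow m)

lemma R_zero (a : ℕ → ℝ) (n m j : ℕ) (hj : j < n) : R a n m (a j) = 0 := by
  apply Finset.prod_eq_zero (Finset.mem_range.2 hj)
  simp [g]

lemma R_tendsto (a : ℕ → ℝ) (n : ℕ) (x : ℝ) (hx : ∀ j < n, ∀ k : ℤ, x - a j ≠ k) :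
    Tendsto (fun m => R a n m x) atTop (nhds 1) := by
  have : Tendsto (fun m => R a n m x) atTop (nhds (∏ j ∈ Finset.range n, (1 - 0 : ℝ))) := by
    apply tendsto_finsetProd
    intro j hj
    apply tendsto_const_nhds.sub
    apply tendsto_pow_atTop_nhds_zero_of_lt_one
    · linarith [g_le_one (a j) x]
    · linarith [g_pos_of (a j) x (hx j (Finset.mem_range.1 hj))]
  simpa using this

lemma key (a : ℕ → ℝ) (t : ℝ) (k : ℕ) : ∃ c : ℝ, 0 < c ∧ ∀ n : ℕ, ∃ φ : ℝ → ℝ,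
    ContDiff ℝ (⊤ : ℕ∞) φ ∧ Function.Periodic φ 1 ∧ (∀ x, 0 ≤ φ x) ∧
    (∀ x, φ x ≤ (1 / 2 : ℝ) ^ (k + 1) * g t x) ∧ (∀ x, 1 / ((k : ℝ) + 1) ≤ g t x → φ x = 0) ∧
    (∀ j < n, φ (a j) = 0) ∧ c ≤ ∫ u in (0:ℝ)..1, φ u := by
  have hI := B_int_pos t k
  refine ⟨(∫ u in (0:ℝ)..1, B t k u) / 2, by linarith, fun n => ?_⟩
  have hT : Tendsto (fun m => ∫ u in (0:ℝ)..1, B t k u * R a n m u) atTop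
      (nhds (∫ u in (0:ℝ)..1, B t k u)) := by
    apply intervalIntegral.tendsto_integral_filter_of_dominated_convergence (B t k)
    · refine Eventually.of_forall fun m => ?_
      exact ((B_smooth t k).continuous.mul (R_smooth a n m).continuous).aestronglyMeasurable
    · refine Eventually.of_forall fun m => Eventually.of_forall fun x _ => ?_
      rw [Real.norm_of_nonneg (mul_nonneg (B_nonneg t k x) (R_nonneg a n m x))]
      exact mul_le_of_le_one_right (B_nonneg t k x) (R_le_one a n m x)
    · exact (B_smooth t k).continuous.intervalIntegrable _ _
    · have hc : (⋃ j : ℕ, ⋃ k : ℤ, {a j + (k : ℝ)}).Countable :=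
        countable_iUnion fun j => countable_iUnion fun k => countable_singleton _
      filter_upwards [hc.ae_notMem volume] with x hx _
      have := (R_tendsto a n x (fun j _ k hk => hx (by
        simp only [mem_iUnion, mem_singleton_iff]
        exact ⟨j, k, by linarith⟩))).const_mul (B t k x)
      simpa using this
  obtain ⟨m, hm⟩ := (hT.eventually_const_le (half_lt_self hI)).exists
  refine ⟨fun u => B t k u * R a n m u, (B_smooth t k).mul (R_smooth a n m), ?_, ?_, ?_, ?_, ?_, hm⟩
  · intro x; simp only [B, R, g_periodic _ x]
  · exact fun x => mul_nonneg (B_nonneg t k x) (R_nonneg a n m x)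
  · exact fun x => (mul_le_of_le_one_right (B_nonneg t k x) (R_le_one a n m x)).trans (B_le t k x)
  · intro x hx
    have : Real.smoothTransition (1 / ((k : ℝ) + 1) - g t x) = 0 :=
      Real.smoothTransition.zero_of_nonpos (by linarith)
    simp only [B, this, mul_zero, zero_mul]
  · intro j hj; simp [R_zero a n m j hj]

/-- The limit function. -/
lemma limit (t : ℝ) (ψ : ℕ → ℝ → ℝ) (h1 : ∀ k, ContDiff ℝ (⊤ : ℕ∞) (ψ k))
    (h2 : ∀ k, Function.Periodic (ψ k) 1) (h3 : ∀ k x, 0 ≤ ψ k x)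
    (h4 : ∀ k x, ψ k x ≤ (1 / 2 : ℝ) ^ (k + 1) * g t x)
    (h5 : ∀ (k : ℕ) x, 1 / ((k : ℝ) + 1) ≤ g t x → ψ k x = 0) :
    ∃ h : ℝ → ℝ, Function.Periodic h 1 ∧ (∀ x : ℝ, DifferentiableAt ℝ h x) ∧
      (∀ x : ℝ, (∀ k : ℤ, x - t ≠ k) → ContDiffAt ℝ (⊤ : ℕ∞) h x) ∧
      (∀ k x, ∑ i ∈ Finset.range k, ψ i x ≤ h x) ∧
      (∀ k x, (∀ i, k ≤ i → ψ i x = 0) → h x = ∑ i ∈ Finset.range k, ψ i x) := by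
  have hgeo : ∀ x, HasSum (fun k : ℕ => (1 / 2 : ℝ) ^ (k + 1) * g t x) (g t x) := by
    intro x
    have := (hasSum_geometric_two.mul_left (1/2 : ℝ)).mul_right (g t x)
    simpa [pow_succ'] using this
  have hs : ∀ x, Summable (fun k => ψ k x) := fun x =>
    Summable.of_nonneg_of_le (fun k => h3 k x) (fun k => h4 k x) (hgeo x).summable
  have hle : ∀ x, ∑' k, ψ k x ≤ g t x := fun x => by
    rw [← (hgeo x).tsum_eq]
    exact (hs x).tsum_le_tsum (fun k => h4 k x) (hgeo x).summable
  have h0 : ∀ x, 0 ≤ ∑' k, ψ k x := fun x => tsum_nonneg fun k => h3 k x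
  have hfin : ∀ k x, (∀ i, k ≤ i → ψ i x = 0) → ∑' i, ψ i x = ∑ i ∈ Finset.range k, ψ i x := by
    intro k x hk
    apply tsum_eq_sum
    intro i hi
    exact hk i (by simpa using hi)
  have hsm : ∀ x : ℝ, (∀ k : ℤ, x - t ≠ k) →
      ContDiffAt ℝ (⊤ : ℕ∞) (fun x => ∑' k, ψ k x) x := by
    intro x hx
    have hg := g_pos_of t x hx
    obtain ⟨K, hK⟩ := exists_nat_one_div_lt hg
    have hev : ∀ᶠ y in nhds x, 1 / ((K : ℝ) + 1) < g t y :=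
      (g_smooth t).continuous.continuousAt.eventually_const_lt hK
    have heq : (fun x => ∑' k, ψ k x) =ᶠ[nhds x] fun y => ∑ i ∈ Finset.range K, ψ i y := by
      filter_upwards [hev] with y hy
      apply hfin
      intro i hi
      apply h5
      refine le_trans ?_ hy.le
      gcongr
    refine ContDiffAt.congr_of_eventuallyEq ?_ heq
    exact (ContDiff.sum fun i _ => h1 i).contDiffAt
  refine ⟨fun x => ∑' k, ψ k x, ?_, ?_, hsm, ?_, hfin⟩
  · intro x; simp only [h2 _ x]
  · intro x
    by_cases hx : ∀ k : ℤ, x - t ≠ k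
    · exact (hsm x hx).differentiableAt (by simp)
    · push Not at hx
      obtain ⟨k, hk⟩ := hx
      have hgx : g t x = 0 := by
        unfold g; rw [hk, mul_comm, Real.sin_int_mul_pi]; simp
      have hd : HasDerivAt (g t) 0 x := by
        have hmin : IsLocalMin (g t) x := Eventually.of_forall fun y => by
          rw [hgx]; exact g_nonneg t y
        have := ((g_smooth t).differentiable (by simp) x).hasDerivAt
        rwa [hmin.deriv_eq_zero] at this
      have hx0 : ∑' k, ψ k x = 0 := le_antisymm (hgx ▸ hle x) (h0 x)
      have : HasDerivAt (fun x => ∑' k, ψ k x) 0 x := by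
        rw [hasDerivAt_iff_isLittleO] at hd ⊢
        refine Asymptotics.IsBigO.trans_isLittleO ?_ hd
        refine Asymptotics.IsBigO.of_bound 1 (Eventually.of_forall fun y => ?_)
        simp only [hx0, hgx, smul_zero, sub_zero, one_mul]
        rw [Real.norm_of_nonneg (h0 y), Real.norm_of_nonneg (g_nonneg t y)]
        exact hle y
      exact this.differentiableAt
  · intro k x
    exact (hs x).sum_le_tsum _ (fun i _ => h3 i x)

end FZ

/-- Theorem 6 of Ford–Zaharescu: a negative result for arbitrary sequences. -/
theorem ford_zaharescu_negative (a : ℕ → ℝ) (t : ℝ) (f : ℝ → ℝ)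
    (hf_anti : Antitone f) (hf0 : Filter.Tendsto f Filter.atTop (nhds 0)) :
    ∃ h : ℝ → ℝ, Function.Periodic h 1 ∧ Continuous h ∧
      (∀ x : ℝ, DifferentiableAt ℝ h x) ∧
      (∀ x : ℝ, (∀ k : ℤ, x - t ≠ k) → ContDiffAt ℝ (⊤ : ℕ∞) h x) ∧
      {n : ℕ | 0 < n ∧
        f n ≤ |(1 / (n : ℝ)) * ∑ j ∈ Finset.range n, h (a j) - ∫ u in (0:ℝ)..1, h u|}.Infinite := by
  classical
  by_contra hcon
  push Not at hcon
  have hf0' : ∀ x, 0 ≤ f x := fun x => hf_anti.le_of_tendsto hf0 x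
  choose c hc φ hφ using FZ.key a t
  have step : ∀ (k : ℕ) (s : ℕ × {S : ℝ → ℝ // ContDiff ℝ (⊤ : ℕ∞) S ∧ Function.Periodic S 1}),
      ∃ n : ℕ, s.1 < n ∧ 2 * f n ≤ c k ∧
        |(1 / (n : ℝ)) * ∑ j ∈ Finset.range n, s.2.1 (a j) - ∫ u in (0:ℝ)..1, s.2.1 u| < f n := by
    rintro k ⟨n0, S, hS, hSp⟩
    have hfin := hcon S hSp hS.continuous (fun x => hS.differentiable (by simp) x)
      (fun x _ => hS.contDiffAt)
    have e1 : ∀ᶠ n : ℕ in atTop, n ∉ {n : ℕ | 0 < n ∧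
        f n ≤ |(1 / (n : ℝ)) * ∑ j ∈ Finset.range n, S (a j) - ∫ u in (0:ℝ)..1, S u|} := by
      rw [← Nat.cofinite_eq_atTop]; exact hfin.eventually_cofinite_notMem
    have e2 : ∀ᶠ n : ℕ in atTop, f n < c k / 2 :=
      (hf0.comp tendsto_natCast_atTop_atTop).eventually_lt_const (half_pos (hc k))
    obtain ⟨n, h1, h2, h3⟩ := (e1.and (e2.and (eventually_gt_atTop n0))).exists
    refine ⟨n, h3, by linarith, ?_⟩
    by_contra h4
    exact h1 ⟨by omega, not_lt.1 h4⟩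
  choose N hN1 hN2 hN3 using step
  let σ : ℕ → ℕ × {S : ℝ → ℝ // ContDiff ℝ (⊤ : ℕ∞) S ∧ Function.Periodic S 1} := fun k =>
    Nat.rec (0, ⟨fun _ => 0, contDiff_const, fun _ => rfl⟩)
      (fun k s => (N k s, ⟨fun x => s.2.1 x + φ k (N k s) x,
        s.2.2.1.add (hφ k (N k s)).1, fun x => by
          simp only [s.2.2.2 x, (hφ k (N k s)).2.1 x]⟩)) k
  let n : ℕ → ℕ := fun k => N k (σ k)
  have hσ : ∀ k x, (σ k).2.1 x = ∑ i ∈ Finset.range k, φ i (n i) x := by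
    intro k x
    induction k with
    | zero => rfl
    | succ k ih => rw [Finset.sum_range_succ, ← ih]
  have hn : StrictMono n := strictMono_nat_of_lt_succ fun k => hN1 (k + 1) (σ (k + 1))
  obtain ⟨h, hper, hdiff, hsm, hge, hfs⟩ := FZ.limit t (fun k => φ k (n k))
    (fun k => (hφ k (n k)).1) (fun k => (hφ k (n k)).2.1) (fun k => (hφ k (n k)).2.2.1)
    (fun k => (hφ k (n k)).2.2.2.1) (fun k => (hφ k (n k)).2.2.2.2.1)
  have hcont : Continuous h := continuous_iff_continuousAt.2 fun x => (hdiff x).continuousAt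
  refine absurd (hcon h hper hcont hdiff hsm) (Set.infinite_of_injective_forall_mem hn.injective fun k => ?_)
  have hpos : 0 < n k := lt_of_le_of_lt (Nat.zero_le _) (hN1 k (σ k))
  refine ⟨hpos, ?_⟩
  have hS := (σ k).2.2.1.continuous
  have hφc := (hφ k (n k)).1.continuous
  have hsum : ∑ j ∈ Finset.range (n k), h (a j) = ∑ j ∈ Finset.range (n k), (σ k).2.1 (a j) := by
    apply Finset.sum_congr rfl
    intro j hj
    rw [hσ]
    apply hfs
    intro i hi
    exact (hφ i (n i)).2.2.2.2.2.1 j (lt_of_lt_of_le (Finset.mem_range.1 hj) (hn.monotone hi))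
  have hint : (∫ u in (0:ℝ)..1, (σ k).2.1 u) + c k ≤ ∫ u in (0:ℝ)..1, h u := by
    have h1 : (∫ u in (0:ℝ)..1, ((σ k).2.1 u + φ k (n k) u)) ≤ ∫ u in (0:ℝ)..1, h u := by
      apply intervalIntegral.integral_mono (by norm_num) ((hS.add hφc).intervalIntegrable _ _)
        (hcont.intervalIntegrable _ _)
      intro x
      have := hge (k + 1) x
      rw [Finset.sum_range_succ, ← hσ] at this
      exact this
    rw [intervalIntegral.integral_add (hS.intervalIntegrable _ _) (hφc.intervalIntegrable _ _)] at h1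
    have := (hφ k (n k)).2.2.2.2.2.2
    linarith
  have h3 := hN3 k (σ k)
  have h2 := hN2 k (σ k)
  change 2 * f (n k) ≤ c k at h2
  change |(1 / (n k : ℝ)) * ∑ j ∈ Finset.range (n k), (σ k).2.1 (a j) -
    ∫ u in (0:ℝ)..1, (σ k).2.1 u| < f (n k) at h3
  rw [hsum, le_abs]
  right
  have := (abs_lt.1 h3).2
  linarith
end
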